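/- arXiv:1311.7475 — 2 statements merged into one kernel-verified Lean document; each statement's English description precedes it below -/
import Mathlib

section
/- Let q = (−u, 0) ∈ M̃ with 0 < u < t₀, and let ν ∈ (inf m, m(u)). Let α_ν and β_ν denote the unit-speed geodesics emanating from q with Clairaut constant ν such that t'(α_ν)(0) < 0 < t'(β_ν)(0). Then, setting s₂ := min{s > 0 : t(α_ν(s)) = u}, s₁⁺ := min{s > 0 : t(β_ν(s)) = ξ(ν)} and s₂⁺ := min{s > s₁⁺ : t(β_ν(s)) = u}, both geodesics pass through the common point (u, φ(ν)); that is, α_ν(s₂) = β_ν(s₂⁺) = (u, φ(ν)). -/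
open Real Set

noncomputable section

/-- Length of a C¹ curve `c` on `[a,b]` in the warped product metric
`ds² = dt² + m(t)² dθ²` on `M̃ = ℝ²` (coordinates `(t,θ)`). -/
def wLength (m : ℝ → ℝ) (c : ℝ → ℝ × ℝ) (a b : ℝ) : ℝ :=
  ∫ s in a..b,
    Real.sqrt ((deriv (fun u => (c u).1) s) ^ 2 +
      (m (c s).1) ^ 2 * (deriv (fun u => (c u).2) s) ^ 2)

/-- The Riemannian distance on `M̃`: the infimum of lengths of C¹ curves joining `p` to `q`. -/
def wDist (m : ℝ → ℝ) (p q : ℝ × ℝ) : ℝ :=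
  sInf {L : ℝ | ∃ c : ℝ → ℝ × ℝ, ∃ b : ℝ, 0 ≤ b ∧ ContDiff ℝ 1 c ∧
    c 0 = p ∧ c b = q ∧ L = wLength m c 0 b}

/-- `γ = (t(s), θ(s))` is a unit-speed geodesic of the warped product metric:
`t'' = m(t) m'(t) θ'²`, `m(t)² θ'` is constant, and `t'² + m(t)² θ'² = 1`. -/
def IsUnitGeodesic (m : ℝ → ℝ) (γ : ℝ → ℝ × ℝ) : Prop :=
  ContDiff ℝ 2 γ ∧
  (∀ s, deriv (deriv fun u => (γ u).1) s =
      m (γ s).1 * deriv m (γ s).1 * (deriv (fun u => (γ u).2) s) ^ 2) ∧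
  (∃ ν : ℝ, ∀ s, m (γ s).1 ^ 2 * deriv (fun u => (γ u).2) s = ν) ∧
  (∀ s, (deriv (fun u => (γ u).1) s) ^ 2 +
      m (γ s).1 ^ 2 * (deriv (fun u => (γ u).2) s) ^ 2 = 1)

/-- `ν` is the Clairaut constant of the geodesic `γ`: `m(t(s))² θ'(s) = ν` for all `s`. -/
def HasClairaut (m : ℝ → ℝ) (γ : ℝ → ℝ × ℝ) (ν : ℝ) : Prop :=
  ∀ s, m (γ s).1 ^ 2 * deriv (fun u => (γ u).2) s = ν

/-- The (unit-speed) geodesic segment `γ|[0,a]` is minimal: its length `a` equals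
the distance between its endpoints. -/
def IsMinimalSeg (m : ℝ → ℝ) (γ : ℝ → ℝ × ℝ) (a : ℝ) : Prop :=
  wDist m (γ 0) (γ a) = a

/-- `x` is a cut point of `p`: the endpoint of some minimal geodesic segment from `p`
no extension of which is minimal. -/
def IsCutPoint (m : ℝ → ℝ) (p x : ℝ × ℝ) : Prop :=
  ∃ γ : ℝ → ℝ × ℝ, ∃ a : ℝ, IsUnitGeodesic m γ ∧ γ 0 = p ∧ 0 < a ∧ γ a = x ∧
    IsMinimalSeg m γ a ∧ ∀ ε > 0, ¬ IsMinimalSeg m γ (a + ε)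

/-- The cut locus of `p` in `M̃`. -/
def cutLocus (m : ℝ → ℝ) (p : ℝ × ℝ) : Set (ℝ × ℝ) := {x | IsCutPoint m p x}

/-- The Gaussian curvature `K(t) = -m''(t)/m(t)` of the warped product metric. -/
def gaussK (m : ℝ → ℝ) (t : ℝ) : ℝ := -(deriv (deriv m) t) / m t

/-- `ξ(ν) := min {t > 0 | m t = ν}`. -/
def xi (m : ℝ → ℝ) (ν : ℝ) : ℝ := sInf {t : ℝ | 0 < t ∧ m t = ν}

/-- `φ(ν) := 2∫₀^{ξ(ν)} ν / (m(t) √(m(t)² - ν²)) dt`. -/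
def phi (m : ℝ → ℝ) (ν : ℝ) : ℝ :=
  2 * ∫ t in (0:ℝ)..(xi m ν), ν / (m t * Real.sqrt ((m t) ^ 2 - ν ^ 2))

/-- `l(ν) := 2∫_{-ξ(ν)}^{0} m(t) / √(m(t)² - ν²) dt`. -/
def ell (m : ℝ → ℝ) (ν : ℝ) : ℝ :=
  2 * ∫ t in (-(xi m ν))..(0:ℝ), m t / Real.sqrt ((m t) ^ 2 - ν ^ 2)

/-- `inf m`. -/
def infm (m : ℝ → ℝ) : ℝ := ⨅ t : ℝ, m t

/-- `t₀ := sup {t > 0 | m'(t) < 0}`. -/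
def tZero (m : ℝ → ℝ) : ℝ := sSup {t : ℝ | 0 < t ∧ deriv m t < 0}

theorem aux_first_hit (h : ℝ → ℝ) (hc : Continuous h) (c s : ℝ) (h0 : h 0 < c) (hs : 0 ≤ s)
    (hsc : c ≤ h s) : ∃ σ, 0 < σ ∧ σ ≤ s ∧ h σ = c ∧ ∀ r ∈ Ico 0 σ, h r < c := by
  have hne : ({r | 0 ≤ r ∧ c ≤ h r} : Set ℝ).Nonempty := ⟨s, hs, hsc⟩
  have hbd : BddBelow ({r | 0 ≤ r ∧ c ≤ h r} : Set ℝ) := ⟨0, fun r hr => hr.1⟩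
  have hcl : IsClosed ({r | 0 ≤ r ∧ c ≤ h r} : Set ℝ) :=
    (isClosed_le continuous_const continuous_id).inter (isClosed_le continuous_const hc)
  have hmem := hcl.csInf_mem hne hbd
  set σ := sInf ({r | 0 ≤ r ∧ c ≤ h r} : Set ℝ) with hσ
  have hlt : ∀ r ∈ Ico 0 σ, h r < c := by
    intro r hr
    by_contra hcon
    exact absurd (csInf_le hbd ⟨hr.1, not_lt.1 hcon⟩) (not_le.2 hr.2)
  have hpos : 0 < σ := by
    rcases hmem.1.lt_or_eq with h1 | h1
    · exact h1
    · have := hmem.2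
      rw [← h1] at this
      linarith
  refine ⟨σ, hpos, csInf_le hbd ⟨hs, hsc⟩, le_antisymm ?_ hmem.2, hlt⟩
  by_contra hcon
  push Not at hcon
  obtain ⟨r, hr, hr2⟩ := intermediate_value_Ioo hpos.le hc.continuousOn
    (show (c + h σ) / 2 ∈ Ioo (h 0) (h σ) from ⟨by linarith, by linarith⟩)
  have := hlt r ⟨hr.1.le, hr.2⟩
  linarith

theorem aux_lim (y w : ℝ → ℝ) (hy : ∀ s, HasDerivAt y (w s) s) (l B : ℝ)
    (hw : Filter.Tendsto w Filter.atTop (nhds l)) (hB : ∀ s, 0 ≤ s → B ≤ y s) : 0 ≤ l := by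
  by_contra hl
  push Not at hl
  have h1 : ∀ᶠ s in Filter.atTop, w s < l / 2 := hw.eventually_lt_const (by linarith)
  obtain ⟨S, hS⟩ := Filter.eventually_atTop.1 (h1.and (Filter.eventually_ge_atTop (0:ℝ)))
  have hS0 := (hS S le_rfl).2
  have hBS := hB S hS0
  set d := 2 * (y S - B + 1) / (-l) with hd
  have hdp : 0 < d := div_pos (by linarith) (by linarith)
  obtain ⟨c, hc, hc2⟩ := exists_hasDerivAt_eq_slope y w (show S < S + d by linarith)
    (fun z _ => (hy z).continuousAt.continuousWithinAt) (fun z _ => hy z)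
  have h3 := (hS c hc.1.le).1
  rw [hc2, show S + d - S = d by ring, div_lt_iff₀ hdp] at h3
  have h4 : l / 2 * d = -(y S - B + 1) := by
    have hl0 : l ≠ 0 := hl.ne
    rw [hd]; field_simp
  have := hB (S + d) (by linarith)
  linarith

/-- The profile facts used in the dynamics. -/
structure AuxProf (m : ℝ → ℝ) (ν ξ : ℝ) : Prop where
  sm : ContDiff ℝ (⊤:ℕ∞) m
  pos : ∀ t, 0 < m t
  even : ∀ t, m (-t) = m t
  νpos : 0 < ν
  ξpos : 0 < ξ
  gt : ∀ t, -ξ < t → t < ξ → ν < m t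
  eq : m ξ = ν
  der : deriv m ξ < 0

/-- Equations of motion of a unit-speed geodesic with Clairaut constant ν. -/
structure AuxLeg (m : ℝ → ℝ) (ν : ℝ) (x v θ : ℝ → ℝ) : Prop where
  hx : ∀ s, HasDerivAt x (v s) s
  hv : ∀ s, HasDerivAt v (deriv m (x s) * ν ^ 2 / m (x s) ^ 3) s
  hθ : ∀ s, HasDerivAt θ (ν / m (x s) ^ 2) s
  he : ∀ s, v s ^ 2 = 1 - ν ^ 2 / m (x s) ^ 2

theorem aux_deriv_odd (m : ℝ → ℝ) (h : ∀ t, m (-t) = m t) (t : ℝ) :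
    deriv m (-t) = - deriv m t := by
  have h1 : (fun s => m (-s)) = m := funext h
  have h2 := deriv_comp_neg m t
  rw [h1] at h2
  linarith

theorem AuxLeg.neg {m : ℝ → ℝ} {ν : ℝ} {x v θ : ℝ → ℝ} (h : AuxLeg m ν x v θ)
    (he : ∀ t, m (-t) = m t) : AuxLeg m ν (fun s => -x s) (fun s => -v s) θ where
  hx s := (h.hx s).fun_neg
  hv s := by
    have := (h.hv s).fun_neg
    rw [he, aux_deriv_odd m he]
    exact this.congr_deriv (by ring)
  hθ s := by rw [he]; exact h.hθ s
  he s := by rw [he, neg_sq]; exact h.he s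

theorem AuxLeg.shift {m : ℝ → ℝ} {ν : ℝ} {x v θ : ℝ → ℝ} (h : AuxLeg m ν x v θ) (a : ℝ) :
    AuxLeg m ν (fun s => x (s + a)) (fun s => v (s + a)) (fun s => θ (s + a)) where
  hx s := (h.hx (s + a)).comp_add_const s a
  hv s := (h.hv (s + a)).comp_add_const s a
  hθ s := (h.hθ (s + a)).comp_add_const s a
  he s := h.he (s + a)

theorem AuxLeg.vne {m : ℝ → ℝ} {ν ξ : ℝ} {x v θ : ℝ → ℝ} (h : AuxLeg m ν x v θ)
    (P : AuxProf m ν ξ) (s : ℝ) (h1 : -ξ < x s) (h2 : x s < ξ) : v s ≠ 0 := by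
  intro h0
  have h3 := h.he s
  have h4 := P.gt _ h1 h2
  have h5 := P.νpos
  have h6 : ν ^ 2 / m (x s) ^ 2 < 1 := by
    rw [div_lt_one (pow_pos (P.pos _) 2)]
    nlinarith
  rw [h0] at h3
  linarith

theorem AuxLeg.cx {m : ℝ → ℝ} {ν : ℝ} {x v θ : ℝ → ℝ} (h : AuxLeg m ν x v θ) : Continuous x :=
  continuous_iff_continuousAt.2 fun s => (h.hx s).continuousAt

theorem AuxLeg.cv {m : ℝ → ℝ} {ν : ℝ} {x v θ : ℝ → ℝ} (h : AuxLeg m ν x v θ) : Continuous v :=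
  continuous_iff_continuousAt.2 fun s => (h.hv s).continuousAt

theorem AuxLeg.mono {m : ℝ → ℝ} {ν : ℝ} {x v θ : ℝ → ℝ} (h : AuxLeg m ν x v θ) (a b : ℝ)
    (hp : ∀ s ∈ Ioo a b, 0 < v s) : StrictMonoOn x (Icc a b) := by
  apply strictMonoOn_of_deriv_pos (convex_Icc a b) h.cx.continuousOn
  intro s hs
  rw [interior_Icc] at hs
  rw [(h.hx s).deriv]
  exact hp s hs

theorem AuxLeg.vpos {m : ℝ → ℝ} {ν ξ : ℝ} {x v θ : ℝ → ℝ} (h : AuxLeg m ν x v θ)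
    (P : AuxProf m ν ξ) (T : ℝ) (hv0 : 0 < v 0) (hx0 : -ξ < x 0)
    (hT : ∀ s ∈ Ico 0 T, x s < ξ) : ∀ s ∈ Ico 0 T, 0 < v s := by
  intro s hs
  by_contra hcon
  push Not at hcon
  obtain ⟨σ, h1, h2, h3, h4⟩ := aux_first_hit (fun s => -v s) h.cv.neg 0 s (by simpa using hv0)
    hs.1 (by simpa using hcon)
  have hm := h.mono 0 σ (fun r hr => by
    have := h4 r ⟨hr.1.le, hr.2⟩
    simpa using this)
  have h5 := hm ⟨le_rfl, h1.le⟩ ⟨h1.le, le_rfl⟩ h1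
  exact h.vne P σ (by linarith) (hT σ ⟨h1.le, by linarith [hs.2]⟩) (by simpa using h3)

theorem AuxLeg.reach {m : ℝ → ℝ} {ν ξ : ℝ} {x v θ : ℝ → ℝ} (h : AuxLeg m ν x v θ)
    (P : AuxProf m ν ξ) (b : ℝ) (hv0 : 0 < v 0) (hx0 : -ξ < x 0) (hb : x 0 < b) (hbξ : b ≤ ξ) :
    ∃ T, 0 < T ∧ x T = b ∧ ∀ s ∈ Ico 0 T, x s < b ∧ 0 < v s := by
  by_cases hex : ∃ s, 0 ≤ s ∧ b ≤ x s
  · obtain ⟨s, hs, hbs⟩ := hex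
    obtain ⟨T, h1, h2, h3, h4⟩ := aux_first_hit x h.cx b s hb hs hbs
    exact ⟨T, h1, h3, fun r hr =>
      ⟨h4 r hr, h.vpos P T hv0 hx0 (fun q hq => (h4 q hq).trans_le hbξ) r hr⟩⟩
  exfalso
  push Not at hex
  have hvp : ∀ s, 0 ≤ s → 0 < v s := fun s hs =>
    h.vpos P (s + 1) hv0 hx0 (fun q hq => (hex q hq.1).trans_le hbξ) s ⟨hs, by linarith⟩
  have hmono : ∀ r s, 0 ≤ r → r ≤ s → x r ≤ x s := fun r s hr hrs =>
    (h.mono 0 s (fun q hq => hvp q hq.1.le)).monotoneOn ⟨hr, hrs⟩ ⟨hr.trans hrs, le_rfl⟩ hrs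
  have hM : Monotone (fun s => x (max s 0)) := fun r s hrs =>
    hmono _ _ (le_max_right _ _) (max_le_max_right 0 hrs)
  have hB : BddAbove (range fun s => x (max s 0)) := by
    refine ⟨b, ?_⟩
    rintro _ ⟨s, rfl⟩
    exact (hex _ (le_max_right _ _)).le
  have hL := tendsto_atTop_ciSup hM hB
  set L := ⨆ s, x (max s 0) with hLdef
  have hxL : Filter.Tendsto x Filter.atTop (nhds L) := by
    refine hL.congr' ?_
    filter_upwards [Filter.eventually_ge_atTop (0:ℝ)] with s hs
    rw [max_eq_left hs]
  have hL0 : x 0 ≤ L := by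
    have := le_ciSup hB 0
    simpa using this
  have hLb : L ≤ b := ciSup_le fun s => (hex _ (le_max_right _ _)).le
  have hmc : Continuous m := P.sm.continuous
  have hdc : Continuous (deriv m) := P.sm.continuous_deriv (by simp)
  have hvL : Filter.Tendsto v Filter.atTop (nhds (Real.sqrt (1 - ν ^ 2 / m L ^ 2))) := by
    have h1 : Filter.Tendsto (fun s => Real.sqrt (1 - ν ^ 2 / m (x s) ^ 2)) Filter.atTop
        (nhds (Real.sqrt (1 - ν ^ 2 / m L ^ 2))) := by
      have h2 := (hmc.tendsto L).comp hxL
      exact (tendsto_const_nhds.sub (tendsto_const_nhds.div (h2.pow 2)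
        (by have := P.pos L; positivity))).sqrt
    refine h1.congr' ?_
    filter_upwards [Filter.eventually_ge_atTop (0:ℝ)] with s hs
    rw [← h.he s, Real.sqrt_sq (hvp s hs).le]
  have h1 := aux_lim (fun s => -x s) (fun s => -v s) (fun s => (h.hx s).fun_neg) _ (-b) hvL.neg
    (fun s hs => by linarith [hex s hs])
  have hLξ : L = ξ := by
    by_contra hne
    have h2 : L < ξ := lt_of_le_of_ne (hLb.trans hbξ) hne
    have h4 := P.gt L (by linarith) h2
    have h5 := P.νpos
    have h6 : ν ^ 2 / m L ^ 2 < 1 := by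
      rw [div_lt_one (pow_pos (P.pos _) 2)]
      nlinarith
    have := Real.sqrt_pos.2 (show 0 < 1 - ν ^ 2 / m L ^ 2 by linarith)
    linarith
  have hwL : Filter.Tendsto (fun s => deriv m (x s) * ν ^ 2 / m (x s) ^ 3) Filter.atTop
      (nhds (deriv m L * ν ^ 2 / m L ^ 3)) :=
    (((hdc.tendsto L).comp hxL).mul_const _).div (((hmc.tendsto L).comp hxL).pow 3)
      (by have := P.pos L; positivity)
  have h2 := aux_lim v _ h.hv _ 0 hwL (fun s hs => (hvp s hs).le)
  have h3 : deriv m L * ν ^ 2 / m L ^ 3 < 0 := by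
    have := P.pos L
    have h5 := P.νpos
    have := P.der
    rw [← hLξ] at this
    exact div_neg_of_neg_of_pos (mul_neg_of_neg_of_pos this (by positivity)) (by positivity)
  linarith

theorem AuxLeg.cov {m : ℝ → ℝ} {ν ξ : ℝ} {x v θ : ℝ → ℝ} (h : AuxLeg m ν x v θ)
    (P : AuxProf m ν ξ) (a b : ℝ) (hab : a < b) (hp : ∀ s ∈ Ioo a b, 0 < v s) :
    IntervalIntegrable (fun t => ν / (m t * Real.sqrt ((m t) ^ 2 - ν ^ 2))) MeasureTheory.volume
      (x a) (x b) ∧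
    ∫ t in (x a)..(x b), ν / (m t * Real.sqrt ((m t) ^ 2 - ν ^ 2)) = θ b - θ a := by
  have hm := h.mono a b hp
  have hxab : x a < x b := hm ⟨le_rfl, hab.le⟩ ⟨hab.le, le_rfl⟩ hab
  have hinj : InjOn x (Ioo a b) := hm.injOn.mono Ioo_subset_Icc_self
  have himg : x '' Ioo a b = Ioo (x a) (x b) := by
    apply Subset.antisymm
    · rintro _ ⟨s, hs, rfl⟩
      exact ⟨hm ⟨le_rfl, hab.le⟩ (Ioo_subset_Icc_self hs) hs.1,
        hm (Ioo_subset_Icc_self hs) ⟨hab.le, le_rfl⟩ hs.2⟩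
    · exact intermediate_value_Ioo hab.le h.cx.continuousOn
  have hpt : ∀ s ∈ Ioo a b, |v s| • (fun t => ν / (m t * Real.sqrt ((m t) ^ 2 - ν ^ 2))) (x s)
      = ν / m (x s) ^ 2 := by
    intro s hs
    have hv := hp s hs
    have hmp := P.pos (x s)
    have h1 : m (x s) ^ 2 - ν ^ 2 = (m (x s) * v s) ^ 2 := by
      rw [mul_pow, h.he s]; field_simp
    simp only [smul_eq_mul]
    rw [abs_of_pos hv, h1, Real.sqrt_sq (by positivity)]
    field_simp
  have hcont : Continuous (fun s => ν / m (x s) ^ 2) :=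
    continuous_const.div ((P.sm.continuous.comp h.cx).pow 2)
      (fun s => by have := P.pos (x s); positivity)
  have hII : IntervalIntegrable (fun s => ν / m (x s) ^ 2) MeasureTheory.volume a b :=
    hcont.intervalIntegrable a b
  have hd : ∀ s ∈ Ioo a b, HasDerivWithinAt x (v s) (Ioo a b) s :=
    fun s _ => (h.hx s).hasDerivWithinAt
  constructor
  · rw [intervalIntegrable_iff_integrableOn_Ioo_of_le hxab.le, ← himg,
      MeasureTheory.integrableOn_image_iff_integrableOn_abs_deriv_smul measurableSet_Ioo hd hinj]
    rw [MeasureTheory.integrableOn_congr_fun hpt measurableSet_Ioo]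
    exact (intervalIntegrable_iff_integrableOn_Ioo_of_le hab.le).1 hII
  · rw [intervalIntegral.integral_of_le hxab.le, MeasureTheory.integral_Ioc_eq_integral_Ioo,
      ← himg, MeasureTheory.integral_image_eq_integral_abs_deriv_smul measurableSet_Ioo hd hinj,
      MeasureTheory.setIntegral_congr_fun measurableSet_Ioo hpt,
      ← MeasureTheory.integral_Ioc_eq_integral_Ioo, ← intervalIntegral.integral_of_le hab.le]
    exact intervalIntegral.integral_eq_sub_of_hasDerivAt (fun s _ => h.hθ s) hII

/-- Motion from a turning point `ξ` down to `x₁`. -/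
theorem AuxLeg.down {m : ℝ → ℝ} {ν ξ : ℝ} {x v θ : ℝ → ℝ} (h : AuxLeg m ν x v θ)
    (P : AuxProf m ν ξ) (x₁ : ℝ) (h0 : x 0 = ξ) (h1 : -ξ < x₁) (h2 : x₁ < ξ) :
    ∃ T, 0 < T ∧ x T = x₁ ∧ (∀ s ∈ Ioo 0 T, x₁ < x s ∧ v s < 0) := by
  have hv0 : v 0 = 0 := by
    have := h.he 0
    have hν := P.νpos
    rw [h0, P.eq, div_self (by positivity), sub_self] at this
    exact pow_eq_zero_iff (two_ne_zero) |>.1 this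
  have hneg : deriv m (x 0) * ν ^ 2 / m (x 0) ^ 3 < 0 := by
    have := P.pos (x 0)
    have h5 := P.νpos
    have := P.der
    rw [← h0] at this
    exact div_neg_of_neg_of_pos (mul_neg_of_neg_of_pos this (by positivity)) (by positivity)
  -- small time
  have hev : ∀ᶠ s in nhdsWithin 0 (Ioi 0), v s < 0 := by
    have h3 := (hasDerivAt_iff_tendsto_slope.1 (h.hv 0)).eventually_lt_const hneg
    have h4 : ∀ᶠ s in nhdsWithin (0:ℝ) (Ioi 0), slope v 0 s < 0 :=
      h3.filter_mono (nhdsWithin_mono _ (fun s (hs : 0 < s) => hs.ne'))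
    filter_upwards [h4, self_mem_nhdsWithin] with s hs hs0
    rw [slope_def_field, hv0, sub_zero, sub_zero] at hs
    have hs0 : 0 < s := hs0
    by_contra hc
    push Not at hc
    exact absurd (div_nonneg hc hs0.le) (not_le.2 hs)
  have hev2 : ∀ᶠ s in nhdsWithin 0 (Ioi 0), x₁ < x s :=
    (h.cx.tendsto 0).eventually_const_lt (by rw [h0]; exact h2) |>.filter_mono nhdsWithin_le_nhds
  obtain ⟨e, he, hee⟩ := mem_nhdsGT_iff_exists_Ioo_subset.1 (hev.and hev2)
  have he : 0 < e := he
  set ε := e / 2 with hε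
  have hε0 : 0 < ε := by linarith
  have hεe : ε < e := by linarith
  have hN := h.neg P.even
  have hdec := hN.mono 0 ε (fun s hs => by
    have := (hee ⟨hs.1, by linarith [hs.2]⟩ : v s < 0 ∧ x₁ < x s).1
    linarith)
  have hxε : x ε < ξ := by
    have := hdec ⟨le_rfl, hε0.le⟩ ⟨hε0.le, le_rfl⟩ hε0
    simp only at this
    linarith
  obtain ⟨hvε, hx1ε⟩ := (hee ⟨hε0, hεe⟩ : v ε < 0 ∧ x₁ < x ε)
  obtain ⟨T, hT, hT1, hT2⟩ := (hN.shift ε).reach P (-x₁) (by simpa using hvε)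
    (by simpa using hxε) (by simpa using hx1ε) (by linarith)
  refine ⟨T + ε, by linarith, by simpa using hT1, ?_⟩
  intro s hs
  rcases lt_or_ge s e with hse | hse
  · exact (hee ⟨hs.1, hse⟩ : v s < 0 ∧ x₁ < x s).symm
  · have := hT2 (s - ε) ⟨by linarith, by linarith [hs.2]⟩
    simp only [sub_add_cancel] at this
    exact ⟨by linarith [this.1], by linarith [this.2]⟩

theorem aux_gsym {m : ℝ → ℝ} (he : ∀ t, m (-t) = m t) (ν a b : ℝ) :
    ∫ t in (-a)..(-b), ν / (m t * Real.sqrt ((m t) ^ 2 - ν ^ 2))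
      = ∫ t in b..a, ν / (m t * Real.sqrt ((m t) ^ 2 - ν ^ 2)) := by
  rw [← intervalIntegral.integral_comp_neg]
  simp only [he]

theorem AuxLeg.main {m : ℝ → ℝ} {ν ξ : ℝ} {x v θ : ℝ → ℝ} (h : AuxLeg m ν x v θ)
    (P : AuxProf m ν ξ) (x₁ : ℝ) (hv0 : 0 < v 0) (h0 : -ξ < x 0) (h0' : x 0 < ξ)
    (h1 : -ξ < x₁) (h2 : x₁ < ξ) :
    ∃ s₁ s₂, 0 < s₁ ∧ s₁ < s₂ ∧ x s₁ = ξ ∧ x s₂ = x₁ ∧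
      (∀ s ∈ Ioo 0 s₁, x 0 < x s ∧ x s < ξ) ∧ (∀ s ∈ Ioo s₁ s₂, x₁ < x s) ∧
      IntervalIntegrable (fun t => ν / (m t * Real.sqrt ((m t) ^ 2 - ν ^ 2)))
        MeasureTheory.volume (x 0) ξ ∧
      θ s₂ - θ 0 = (∫ t in (x 0)..ξ, ν / (m t * Real.sqrt ((m t) ^ 2 - ν ^ 2))) +
        ∫ t in x₁..ξ, ν / (m t * Real.sqrt ((m t) ^ 2 - ν ^ 2)) := by
  obtain ⟨s₁, hs1, hx1, hl1⟩ := h.reach P ξ hv0 h0 h0' le_rfl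
  obtain ⟨T, hT, hT1, hT2⟩ := (h.shift s₁).down P x₁ (by simpa using hx1) h1 h2
  have hm := h.mono 0 s₁ (fun s hs => (hl1 s ⟨hs.1.le, hs.2⟩).2)
  have c1 := h.cov P 0 s₁ hs1 (fun s hs => (hl1 s ⟨hs.1.le, hs.2⟩).2)
  have c2 := (h.neg P.even).cov P s₁ (T + s₁) (by linarith) (fun s hs => by
    have := (hT2 (s - s₁) ⟨by linarith [hs.1], by linarith [hs.2]⟩).2
    simp only [sub_add_cancel] at this
    linarith)
  refine ⟨s₁, T + s₁, hs1, by linarith, hx1, hT1, ?_, ?_, ?_, ?_⟩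
  · intro s hs
    exact ⟨hm ⟨le_rfl, hs1.le⟩ ⟨hs.1.le, hs.2.le⟩ hs.1, (hl1 s ⟨hs.1.le, hs.2⟩).1⟩
  · intro s hs
    have := (hT2 (s - s₁) ⟨by linarith [hs.1], by linarith [hs.2]⟩).1
    simpa using this
  · rw [← hx1]; exact c1.1
  · have e1 := c1.2
    have e2 := c2.2
    rw [aux_gsym P.even, hT1, hx1] at e2
    rw [hx1] at e1
    rw [e1, e2]; ring

theorem aux_phi {m : ℝ → ℝ} (he : ∀ t, m (-t) = m t) (ν u : ℝ) (hu : 0 < u)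
    (huξ : u < xi m ν)
    (hI : IntervalIntegrable (fun t => ν / (m t * Real.sqrt ((m t) ^ 2 - ν ^ 2)))
        MeasureTheory.volume (-u) (xi m ν)) :
    (∫ t in (-u)..(xi m ν), ν / (m t * Real.sqrt ((m t) ^ 2 - ν ^ 2))) +
        ∫ t in u..(xi m ν), ν / (m t * Real.sqrt ((m t) ^ 2 - ν ^ 2)) = phi m ν := by
  set g := fun t => ν / (m t * Real.sqrt ((m t) ^ 2 - ν ^ 2)) with hg
  have hsub : ∀ a b, -u ≤ a → a ≤ b → b ≤ xi m ν →
      IntervalIntegrable g MeasureTheory.volume a b := fun a b h1 h2 h3 =>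
    hI.mono_set (by rw [uIcc_of_le h2, uIcc_of_le (by linarith)]; exact Icc_subset_Icc h1 h3)
  have e1 := intervalIntegral.integral_add_adjacent_intervals (hsub (-u) 0 le_rfl (by linarith)
    (by linarith)) (hsub 0 (xi m ν) (by linarith) (by linarith) le_rfl)
  have e2 := intervalIntegral.integral_add_adjacent_intervals (hsub 0 u (by linarith) hu.le
    huξ.le) (hsub u (xi m ν) (by linarith) huξ.le le_rfl)
  have e3 := aux_gsym he ν u 0
  rw [neg_zero] at e3
  unfold phi
  rw [← e1]
  linarith

theorem aux_leg_of_geodesic {m : ℝ → ℝ} (hmpos : ∀ t, 0 < m t) {ν : ℝ} {γ : ℝ → ℝ × ℝ}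
    (hγ : IsUnitGeodesic m γ) (hcl : HasClairaut m γ ν) :
    AuxLeg m ν (fun s => (γ s).1) (deriv fun s => (γ s).1) (fun s => (γ s).2) := by
  obtain ⟨hc, h2, -, h4⟩ := hγ
  have hc1 : ContDiff ℝ 2 (fun s => (γ s).1) := hc.fst
  have hc2 : ContDiff ℝ 2 (fun s => (γ s).2) := hc.snd
  have hd : Differentiable ℝ (deriv fun s => (γ s).1) :=
    ((contDiff_succ_iff_deriv (n := 1)).1 hc1).2.2.differentiable (by simp)
  have hθ : ∀ s, deriv (fun s => (γ s).2) s = ν / m (γ s).1 ^ 2 := by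
    intro s
    have := hmpos (γ s).1
    rw [eq_div_iff (by positivity), mul_comm]
    exact hcl s
  refine ⟨fun s => (hc1.differentiable (by simp) s).hasDerivAt, fun s => ?_, fun s => ?_,
    fun s => ?_⟩
  · have := hmpos (γ s).1
    have h := (hd s).hasDerivAt
    rw [h2 s, hθ s] at h
    exact h.congr_deriv (by field_simp)
  · rw [← hθ s]
    exact (hc2.differentiable (by simp) s).hasDerivAt
  · have := hmpos (γ s).1
    have h := h4 s
    rw [hθ s] at h
    have e : m (γ s).1 ^ 2 * (ν / m (γ s).1 ^ 2) ^ 2 = ν ^ 2 / m (γ s).1 ^ 2 := by field_simp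
    rw [e] at h
    linarith

theorem aux_deriv_neg {m : ℝ → ℝ} (hm : ContDiff ℝ (⊤:ℕ∞) m) (hmpos : ∀ t, 0 < m t)
    (hmeven : ∀ t, m (-t) = m t) (hKdec : AntitoneOn (gaussK m) (Ici 0))
    (s t : ℝ) (hs : 0 < s) (hst : s ≤ t) (ht : deriv m t < 0) : deriv m s < 0 := by
  by_contra hcon
  push Not at hcon
  have hd1 : ContDiff ℝ (⊤:ℕ∞) (deriv m) := (contDiff_infty_iff_deriv.1 hm).2
  have hdc : Continuous (deriv m) := hd1.continuous
  have hm0 : deriv m 0 = 0 := by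
    have := aux_deriv_odd m hmeven 0
    rw [neg_zero] at this
    linarith
  have hK : ∀ r, deriv (deriv m) r = - (gaussK m r * m r) := by
    intro r
    unfold gaussK
    have := hmpos r
    field_simp
  rcases lt_or_ge 0 (gaussK m s) with h | h
  · have : StrictAntiOn (deriv m) (Icc 0 s) := by
      apply strictAntiOn_of_deriv_neg (convex_Icc 0 s) hdc.continuousOn
      intro r hr
      rw [interior_Icc] at hr
      rw [hK]
      have h1 := hKdec (mem_Ici.2 hr.1.le) (mem_Ici.2 hs.le) hr.2.le
      have h2 := mul_pos (h.trans_le h1) (hmpos r)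
      linarith
    have := this ⟨le_rfl, hs.le⟩ ⟨hs.le, le_rfl⟩ hs
    linarith
  · have : MonotoneOn (deriv m) (Icc s t) := by
      apply monotoneOn_of_deriv_nonneg (convex_Icc s t) hdc.continuousOn
        (hd1.differentiable (by simp)).differentiableOn
      intro r hr
      rw [interior_Icc] at hr
      rw [hK]
      have h1 := hKdec (mem_Ici.2 hs.le) (mem_Ici.2 (hs.trans hr.1).le) hr.1.le
      have h2 := mul_nonneg (neg_nonneg.2 (h1.trans h)) (hmpos r).le
      linarith
    have := this ⟨le_rfl, hst⟩ ⟨hst, le_rfl⟩ hst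
    linarith

theorem aux_prof {m : ℝ → ℝ} (hm : ContDiff ℝ (⊤:ℕ∞) m) (hmpos : ∀ t, 0 < m t)
    (hmeven : ∀ t, m (-t) = m t) (hKdec : AntitoneOn (gaussK m) (Ici 0))
    (u : ℝ) (hu : 0 < u) (hut : u < tZero m)
    (ν : ℝ) (hν₁ : infm m < ν) (hν₂ : ν < m u) :
    AuxProf m ν (xi m ν) ∧ u < xi m ν := by
  have hneg := aux_deriv_neg hm hmpos hmeven hKdec
  have hmc : Continuous m := hm.continuous
  have hbd : BddBelow (range m) := ⟨0, by rintro _ ⟨t, rfl⟩; exact (hmpos t).le⟩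
  have hνpos : 0 < ν := lt_of_le_of_lt (le_ciInf fun t => (hmpos t).le) hν₁
  have hdiff : Differentiable ℝ m := hm.differentiable (by simp)
  have hanti : ∀ t, deriv m t < 0 → StrictAntiOn m (Icc 0 t) := by
    intro t ht
    apply strictAntiOn_of_deriv_neg (convex_Icc 0 t) hmc.continuousOn
    intro r hr
    rw [interior_Icc] at hr
    exact hneg r t hr.1 hr.2.le ht
  have hum : ∀ t, 0 ≤ t → t ≤ u → ν < m t := by
    intro t h0 h1
    have hne : ({t : ℝ | 0 < t ∧ deriv m t < 0}).Nonempty := by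
      by_contra hc
      rw [Set.not_nonempty_iff_eq_empty] at hc
      unfold tZero at hut
      rw [hc, Real.sSup_empty] at hut
      linarith
    obtain ⟨w, hw, huw⟩ := exists_lt_of_lt_csSup hne hut
    exact hν₂.trans_le ((hanti w hw.2).antitoneOn ⟨h0, by linarith⟩ ⟨hu.le, huw.le⟩ h1)
  obtain ⟨p, hp⟩ := exists_lt_of_ciInf_lt hν₁
  obtain ⟨q, hq0, hq⟩ : ∃ q, 0 ≤ q ∧ m q < ν := by
    rcases le_total 0 p with h | h
    · exact ⟨p, h, hp⟩
    · exact ⟨-p, by linarith, by rw [hmeven]; exact hp⟩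
  obtain ⟨σ, h1, h2, h3, h4⟩ := aux_first_hit (fun t => -m t) hmc.neg (-ν) q
    (by have := hum 0 le_rfl hu.le; linarith) hq0 (by linarith)
  have hσ : m σ = ν := by simpa using h3
  have hlt : ∀ r, 0 ≤ r → r < σ → ν < m r := fun r hr hr2 => by
    have := h4 r ⟨hr, hr2⟩
    linarith
  have hxi : xi m ν = σ := by
    have : IsLeast {t : ℝ | 0 < t ∧ m t = ν} σ := by
      refine ⟨⟨h1, hσ⟩, fun t ht => ?_⟩
      by_contra hc
      push Not at hc
      exact absurd ht.2 (hlt t ht.1.le hc).ne'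
    exact this.csInf_eq
  rw [hxi]
  have hσu : u < σ := by
    by_contra hc
    push Not at hc
    exact absurd hσ (hum σ h1.le hc).ne'
  refine ⟨⟨hm, hmpos, hmeven, hνpos, h1, ?_, hσ, ?_⟩, hσu⟩
  · intro t ht1 ht2
    rcases le_total 0 t with h | h
    · exact hlt t h ht2
    · rw [← hmeven]
      exact hlt (-t) (by linarith) (by linarith)
  · have hσq : σ < q := lt_of_le_of_ne h2 (by rintro rfl; linarith)
    obtain ⟨c, hc, hc2⟩ := exists_deriv_eq_slope m hσq hmc.continuousOn hdiff.differentiableOn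
    refine hneg σ c h1 hc.1.le ?_
    rw [hc2]
    exact div_neg_of_neg_of_pos (by linarith) (by linarith)

/-- Lemma 5.1: let `q = (-u,0)` with `0 < u < t₀` and `ν ∈ (inf m, m u)`.
Let `α`, `β` be the unit-speed geodesics from `q` with Clairaut constant `ν` and
`t'(α)(0) < 0 < t'(β)(0)`.  Then, with `s₂ := min {s > 0 | t(α s) = u}`,
`s₁⁺ := min {s > 0 | t(β s) = ξ(ν)}` and `s₂⁺ := min {s > s₁⁺ | t(β s) = u}`,
both geodesics pass through the common point `(u, φ(ν))`. -/
theorem stmt13 (m : ℝ → ℝ) (hm : ContDiff ℝ (⊤:ℕ∞) m) (hmpos : ∀ t, 0 < m t)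
    (hmeven : ∀ t, m (-t) = m t)
    (hK0 : 0 < gaussK m 0) (hKdec : AntitoneOn (gaussK m) (Ici 0))
    (u : ℝ) (hu : 0 < u) (hut : u < tZero m)
    (ν : ℝ) (hν₁ : infm m < ν) (hν₂ : ν < m u)
    (α β : ℝ → ℝ × ℝ)
    (hα : IsUnitGeodesic m α) (hβ : IsUnitGeodesic m β)
    (hα0 : α 0 = (-u, 0)) (hβ0 : β 0 = (-u, 0))
    (hαcl : HasClairaut m α ν) (hβcl : HasClairaut m β ν)
    (hα' : deriv (fun s => (α s).1) 0 < 0) (hβ' : 0 < deriv (fun s => (β s).1) 0) :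
    ∃ s₂ s₁p s₂p : ℝ,
      IsLeast {s : ℝ | 0 < s ∧ (α s).1 = u} s₂ ∧
      IsLeast {s : ℝ | 0 < s ∧ (β s).1 = xi m ν} s₁p ∧
      IsLeast {s : ℝ | s₁p < s ∧ (β s).1 = u} s₂p ∧
      α s₂ = (u, phi m ν) ∧ β s₂p = (u, phi m ν) := by
  obtain ⟨P, huξ⟩ := aux_prof hm hmpos hmeven hKdec u hu hut ν hν₁ hν₂
  have la := (aux_leg_of_geodesic hmpos hα hαcl).neg hmeven
  have lb := aux_leg_of_geodesic hmpos hβ hβcl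
  obtain ⟨a₁, a₂, ha1, ha12, hxa1, hxa2, hla, hla2, -, hta⟩ := la.main P (-u)
    (by linarith) (by rw [hα0]; simp only; linarith) (by rw [hα0]; simp only; linarith)
    (by linarith) (by linarith)
  obtain ⟨b₁, b₂, hb1, hb12, hxb1, hxb2, hlb, hlb2, hI, htb⟩ := lb.main P u
    hβ' (by rw [hβ0]; simp only; linarith) (by rw [hβ0]; simp only; linarith)
    (by linarith) (by linarith)
  simp only [hα0, hβ0, neg_neg] at *
  have hphi := aux_phi hmeven ν u hu huξ hI
  refine ⟨a₂, b₁, b₂, ⟨⟨by linarith, by linarith⟩, ?_⟩, ⟨⟨hb1, hxb1⟩, ?_⟩, ⟨⟨hb12, hxb2⟩, ?_⟩,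
    ?_, ?_⟩
  · rintro s ⟨hs, hsu⟩
    by_contra hc
    push Not at hc
    rcases lt_trichotomy s a₁ with h | h | h
    · have := (hla s ⟨hs, h⟩).1
      linarith
    · rw [← h] at hxa1
      linarith
    · have := hla2 s ⟨h, hc⟩
      linarith
  · rintro s ⟨hs, hsu⟩
    by_contra hc
    push Not at hc
    have := (hlb s ⟨hs, hc⟩).2
    linarith
  · rintro s ⟨hs, hsu⟩
    by_contra hc
    push Not at hc
    have := hlb2 s ⟨hs, hc⟩
    linarith
  · exact Prod.ext (by simp only; linarith) (by simp only; linarith)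
  · exact Prod.ext (by simp only; linarith) (by simp only; linarith)
end
end

section
/- Let q = (−u, 0) ∈ M̃ with 0 < u < t₀. For every ν ∈ (inf m, m(u)], the geodesic segments α_ν|[0, s₂(ν)] and β_ν|[0, s₂(ν)] (where α_ν, β_ν are the unit-speed geodesics from q with Clairaut constant ν and t'(α_ν)(0) < 0 < t'(β_ν)(0), and s₂(ν) := min{s > 0 : t(α_ν(s)) = u}) are minimal geodesic segments joining q to the point (u, φ(ν)). In particular, the set {(u, θ) : θ ≥ φ(m(u))} is contained in the cut locus C_q. -/
open Real Set

noncomputable section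

/-- Uniqueness for `x' = v, v' = f x`. -/
theorem ode2_unique {f : ℝ → ℝ} {K : NNReal} (hf : LipschitzWith K f) {x v y w : ℝ → ℝ}
    (hx : ∀ s, HasDerivAt x (v s) s) (hv : ∀ s, HasDerivAt v (f (x s)) s)
    (hy : ∀ s, HasDerivAt y (w s) s) (hw : ∀ s, HasDerivAt w (f (y s)) s)
    (s₀ : ℝ) (h1 : x s₀ = y s₀) (h2 : v s₀ = w s₀) : x = y ∧ v = w := by
  have hL : LipschitzWith (max 1 (K * 1)) (fun p : ℝ × ℝ => (p.2, f p.1)) :=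
    LipschitzWith.prod_snd.prodMk (hf.comp LipschitzWith.prod_fst)
  have := ODE_solution_unique_univ (E := ℝ × ℝ) (v := fun _ p => (p.2, f p.1))
    (s := fun _ => univ) (f := fun s => (x s, v s)) (g := fun s => (y s, w s)) (t₀ := s₀)
    (fun t => hL.lipschitzOnWith)
    (fun t => ⟨(hx t).prodMk (hv t), trivial⟩) (fun t => ⟨(hy t).prodMk (hw t), trivial⟩)
    (by simp [h1, h2])
  constructor
  · ext s; exact congrArg Prod.fst (congrFun this s)
  · ext s; exact congrArg Prod.snd (congrFun this s)

theorem clamp_lip (A : ℝ) : LipschitzWith 1 (fun t : ℝ => max (-A) (min t A)) :=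
  (LipschitzWith.id.min_const A).const_max (-A)

theorem clamp_mem {A : ℝ} (hA : 0 ≤ A) (t : ℝ) : |max (-A) (min t A)| ≤ A := by
  rw [abs_le]
  constructor
  · exact le_max_left _ _
  · exact max_le (by linarith) (min_le_right _ _)

theorem clamp_of_abs_le {A t : ℝ} (h : |t| ≤ A) : max (-A) (min t A) = t := by
  rw [abs_le] at h
  rw [min_eq_left h.2, max_eq_right h.1]

/-- Local-in-any-time existence. -/
theorem ode2_exists_T {f : ℝ → ℝ} {K : NNReal} (hf : LipschitzWith K f) {M : ℝ}
    (hM : ∀ t, |f t| ≤ M) (x0 v0 T : ℝ) (hT : 0 < T) :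
    ∃ z : ℝ → ℝ × ℝ, z 0 = (x0, v0) ∧
      ∀ s ∈ Ioo (-T) T, HasDerivAt z ((z s).2, f (z s).1) s := by
  have hM0 : 0 ≤ M := (abs_nonneg _).trans (hM 0)
  set B : ℝ := |v0| + M * T with hB
  have hB0 : 0 ≤ B := by positivity
  set X : ℝ × ℝ → ℝ × ℝ := fun p => (max (-B) (min p.2 B), f p.1) with hX
  have hL : LipschitzWith (max (1 * 1) (K * 1)) X :=
    ((clamp_lip B).comp LipschitzWith.prod_snd).prodMk (hf.comp LipschitzWith.prod_fst)
  have hb : ∀ p, ‖X p‖ ≤ max B M := by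
    intro p
    rw [Prod.norm_def]
    exact max_le_max (clamp_mem hB0 _) (hM _)
  have hBM : 0 ≤ max B M := le_max_of_le_left hB0
  have hPL : IsPicardLindelof (fun _ => X) (tmin := -T) (tmax := T) ⟨0, by constructor <;> linarith⟩
      (x0, v0) (Real.toNNReal (max B M * T)) 0 (Real.toNNReal (max B M)) (max (1 * 1) (K * 1)) := by
    apply IsPicardLindelof.of_time_independent
    · intro p _
      rw [Real.coe_toNNReal _ hBM]; exact hb p
    · exact hL.lipschitzOnWith
    · rw [Real.coe_toNNReal _ hBM, Real.coe_toNNReal _ (by positivity)]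
      simp
  obtain ⟨z, hz0, hz⟩ := hPL.exists_eq_forall_mem_Icc_hasDerivWithinAt₀
  have hz' : ∀ s ∈ Ioo (-T) T, HasDerivAt z (X (z s)) s := fun s hs =>
    (hz s (Ioo_subset_Icc_self hs)).hasDerivAt (Icc_mem_nhds hs.1 hs.2)
  refine ⟨z, hz0, fun s hs => ?_⟩
  have hd2 : ∀ r ∈ Ioo (-T) T, HasDerivWithinAt (fun s => (z s).2) (f (z r).1) (Ioo (-T) T) r := by
    intro r hr
    exact ((hasFDerivAt_snd (𝕜 := ℝ) (E := ℝ) (F := ℝ)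
      (p := z r)).comp_hasDerivAt r (hz' r hr)).hasDerivWithinAt
  have hbd : |(z s).2| ≤ B := by
    have h0 : (0:ℝ) ∈ Ioo (-T) T := ⟨by linarith, hT⟩
    have := (convex_Ioo (-T) T).norm_image_sub_le_of_norm_hasDerivWithin_le hd2
      (fun r _ => hM _) h0 hs
    have h2 : |(z s).2 - v0| ≤ M * |s| := by
      have e : (z 0).2 = v0 := by rw [show z 0 = (x0, v0) from hz0]
      simpa [e] using this
    have h3 : |s| ≤ T := abs_le.2 ⟨hs.1.le, hs.2.le⟩
    have h4 : |(z s).2| ≤ |(z s).2 - v0| + |v0| := by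
      simpa using abs_add_le ((z s).2 - v0) v0
    nlinarith
  have := hz' s hs
  simp only [hX, clamp_of_abs_le hbd] at this
  exact this

/-- Global existence. -/
theorem ode2_exists {f : ℝ → ℝ} {K : NNReal} (hf : LipschitzWith K f) {M : ℝ}
    (hM : ∀ t, |f t| ≤ M) (x0 v0 : ℝ) :
    ∃ x v : ℝ → ℝ, x 0 = x0 ∧ v 0 = v0 ∧
      (∀ s, HasDerivAt x (v s) s) ∧ ∀ s, HasDerivAt v (f (x s)) s := by
  have hL : LipschitzWith (max 1 (K * 1)) (fun p : ℝ × ℝ => (p.2, f p.1)) :=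
    LipschitzWith.prod_snd.prodMk (hf.comp LipschitzWith.prod_fst)
  choose! z hz0 hz using ode2_exists_T hf hM x0 v0
  have key : ∀ T₁ T₂ : ℝ, 0 < T₁ → T₁ ≤ T₂ → EqOn (z T₁) (z T₂) (Ioo (-T₁) T₁) := by
    intro T₁ T₂ h1 h2
    refine ODE_solution_unique_of_mem_Ioo (v := fun _ p => (p.2, f p.1)) (s := fun _ => univ)
      (K := max 1 (K * 1)) (t₀ := 0)
      (fun t _ => hL.lipschitzOnWith) ⟨by linarith, h1⟩
      (fun t ht => ⟨hz T₁ h1 t ht, trivial⟩)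
      (fun t ht => ⟨hz T₂ (by linarith) t ⟨by linarith [ht.1], by linarith [ht.2]⟩, trivial⟩) ?_
    rw [hz0 _ h1, hz0 _ (by linarith)]
  set y : ℝ → ℝ × ℝ := fun s => z (|s| + 1) s with hy
  have hyd : ∀ s, HasDerivAt y ((y s).2, f (y s).1) s := by
    intro s
    have hs1 : 0 < |s| + 2 := by positivity
    have hmem : s ∈ Ioo (-(|s|+1)) (|s|+1) := by
      exact abs_lt.1 (by linarith)
    have hev : y =ᶠ[nhds s] z (|s| + 2) := by
      filter_upwards [Ioo_mem_nhds hmem.1 hmem.2] with r hr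
      have hr' : |r| < |s| + 1 := abs_lt.2 hr
      exact key (|r| + 1) (|s| + 2) (by positivity) (by linarith)
        (abs_lt.1 (by linarith))
    have := (hz (|s|+2) hs1 s (abs_lt.1 (by linarith))).congr_of_eventuallyEq hev
    rw [← hev.eq_of_nhds] at this
    exact this
  refine ⟨fun s => (y s).1, fun s => (y s).2, ?_, ?_, ?_, ?_⟩
  · simp [hy, hz0]
  · simp [hy, hz0]
  · intro s
    exact (hasFDerivAt_fst (𝕜 := ℝ) (E := ℝ) (F := ℝ) (p := y s)).comp_hasDerivAt s (hyd s)
  · intro s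
    exact (hasFDerivAt_snd (𝕜 := ℝ) (E := ℝ) (F := ℝ) (p := y s)).comp_hasDerivAt s (hyd s)

/-- Structural facts about `m` used in the rest of the argument. -/
structure Good (m : ℝ → ℝ) (t₀ : ℝ) : Prop where
  smooth : ContDiff ℝ (⊤:ℕ∞) m
  pos : ∀ t, 0 < m t
  even : ∀ t, m (-t) = m t
  t0pos : 0 < t₀
  neg : ∀ t ∈ Ioo 0 t₀, deriv m t < 0
  nonneg : ∀ t, t₀ ≤ t → 0 ≤ deriv m t
  crit : deriv m t₀ = 0
  Kineq : ∀ t ∈ Ioo 0 t₀, -(deriv (deriv m) t) * (m 0 ^ 2 - m t ^ 2) ≤ (deriv m t) ^ 2 * m t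

theorem smooth_d {m : ℝ → ℝ} (hm : ContDiff ℝ (⊤:ℕ∞) m) (t : ℝ) :
    HasDerivAt m (deriv m t) t :=
  ((hm.differentiable (by simp)) t).hasDerivAt

theorem smooth_deriv {m : ℝ → ℝ} (hm : ContDiff ℝ (⊤:ℕ∞) m) :
    ContDiff ℝ (⊤:ℕ∞) (deriv m) :=
  (contDiff_infty_iff_deriv.1 hm).2

theorem deriv_zero_of_even {m : ℝ → ℝ} (he : ∀ t, m (-t) = m t) (t : ℝ) :
    deriv m (-t) = - deriv m t := by
  have : deriv (fun x => m (-x)) t = - deriv m (-t) := deriv_comp_neg m t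
  rw [show (fun x => m (-x)) = m from funext he] at this
  linarith

theorem good_of (m : ℝ → ℝ) (hm : ContDiff ℝ (⊤:ℕ∞) m) (hmpos : ∀ t, 0 < m t)
    (hmeven : ∀ t, m (-t) = m t) (hKdec : AntitoneOn (gaussK m) (Ici 0))
    (u : ℝ) (hu : 0 < u) (hut : u < tZero m) : Good m (tZero m) := by
  set S := {t : ℝ | 0 < t ∧ deriv m t < 0} with hS
  have hSne : S.Nonempty := by
    by_contra h
    rw [not_nonempty_iff_eq_empty] at h
    have : tZero m = 0 := by rw [tZero, ← hS, h, Real.sSup_empty]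
    linarith
  have hSb : BddAbove S := by
    by_contra h
    have : tZero m = 0 := by rw [tZero, ← hS, Real.sSup_of_not_bddAbove h]
    linarith
  have ht0 : 0 < tZero m := hu.trans hut
  have d1 := smooth_d hm
  have d2 := smooth_d (smooth_deriv hm)
  have c1 : Continuous (deriv m) := (smooth_deriv hm).continuous
  have hd0 : deriv m 0 = 0 := by
    have := deriv_zero_of_even hmeven 0
    simp at this; linarith
  have hneg : ∀ t ∈ Ioo 0 (tZero m), deriv m t < 0 := by
    intro t ht
    obtain ⟨t1, ht1, htt⟩ := exists_lt_of_lt_csSup hSne ht.2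
    by_contra hcon
    push Not at hcon
    obtain ⟨c, hc, hc'⟩ := exists_deriv_eq_slope (deriv m) htt c1.continuousOn
      (fun x _ => (d2 x).differentiableAt.differentiableWithinAt)
    have h1 : deriv (deriv m) c < 0 := by
      rw [hc']; apply div_neg_of_neg_of_pos
      · linarith [ht1.2]
      · linarith
    have hKc : 0 < gaussK m c := by
      unfold gaussK; exact div_pos (by linarith) (hmpos c)
    have h2 : ∀ x ∈ Icc 0 c, deriv (deriv m) x < 0 := by
      intro x hx
      have : gaussK m c ≤ gaussK m x := hKdec hx.1 (hx.1.trans hx.2) hx.2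
      have h3 : 0 < gaussK m x := lt_of_lt_of_le hKc this
      unfold gaussK at h3
      have := (div_pos_iff_of_pos_right (hmpos x)).1 h3
      linarith
    have h3 : StrictAntiOn (deriv m) (Icc 0 c) := by
      apply strictAntiOn_of_deriv_neg (convex_Icc 0 c) c1.continuousOn
      intro x hx
      exact h2 x (interior_subset hx)
    have := h3 (a := 0) (b := t) ⟨le_refl _, by linarith [ht.1, hc.1]⟩ ⟨ht.1.le, hc.1.le⟩ ht.1
    linarith
  have hnn' : ∀ t, tZero m < t → 0 ≤ deriv m t := by
    intro t ht
    by_contra h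
    push Not at h
    have : t ≤ tZero m := le_csSup hSb ⟨ht0.trans ht, h⟩
    linarith
  have hcrit : deriv m (tZero m) = 0 := by
    apply le_antisymm
    · have : tZero m ∈ closure (Ioo 0 (tZero m)) := by
        rw [closure_Ioo ht0.ne]; exact ⟨ht0.le, le_refl _⟩
      exact closure_minimal (fun x hx => (hneg x hx).le) (isClosed_le c1 continuous_const) this
    · have : tZero m ∈ closure (Ioi (tZero m)) := by
        rw [closure_Ioi]; exact self_mem_Ici
      exact closure_minimal (fun x hx => hnn' x hx) (isClosed_le continuous_const c1) this
  refine ⟨hm, hmpos, hmeven, ht0, hneg, ?_, hcrit, ?_⟩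
  · intro t ht
    rcases ht.eq_or_lt with h | h
    · rw [← h, hcrit]
    · exact hnn' t h
  · intro T hT
    set k := gaussK m T with hk
    have hk' : -(deriv (deriv m) T) = k * m T := by
      rw [hk, gaussK]; field_simp [(hmpos T).ne']
    have hmono : MonotoneOn (fun t => deriv m t ^ 2 + k * m t ^ 2) (Icc 0 T) := by
      have hd : ∀ t, HasDerivAt (fun t => deriv m t ^ 2 + k * m t ^ 2)
          (2 * deriv m t * deriv (deriv m) t + k * (2 * m t * deriv m t)) t := by
        intro t
        have := ((d2 t).pow 2).add (((d1 t).pow 2).const_mul k)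
        exact HasDerivAt.congr_deriv this (by simp)
      apply monotoneOn_of_deriv_nonneg (convex_Icc 0 T)
      · exact fun t _ => (hd t).continuousAt.continuousWithinAt
      · exact fun t _ => (hd t).differentiableAt.differentiableWithinAt
      · intro t ht
        rw [interior_Icc] at ht
        rw [(hd t).deriv]
        have h1 : k ≤ gaussK m t := hKdec ht.1.le hT.1.le ht.2.le
        have h2 : deriv (deriv m) t = - (gaussK m t * m t) := by
          rw [gaussK]; field_simp [(hmpos t).ne']
        have h3 := hneg t ⟨ht.1, ht.2.trans hT.2⟩
        rw [h2]
        have := mul_nonneg (mul_nonneg (neg_nonneg.2 h3.le) (hmpos t).le) (sub_nonneg.2 h1)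
        nlinarith
    have := hmono (a := 0) (b := T) ⟨le_refl _, hT.1.le⟩ ⟨hT.1.le, le_refl _⟩ hT.1.le
    simp only [hd0] at this
    rw [hk']
    nlinarith [hmpos T]

namespace Good
variable {m : ℝ → ℝ} {t₀ : ℝ}

theorem d1 (g : Good m t₀) (t : ℝ) : HasDerivAt m (deriv m t) t := smooth_d g.smooth t
theorem d2 (g : Good m t₀) (t : ℝ) : HasDerivAt (deriv m) (deriv (deriv m) t) t :=
  smooth_d (smooth_deriv g.smooth) t
theorem c0 (g : Good m t₀) : Continuous m := g.smooth.continuous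
theorem c1 (g : Good m t₀) : Continuous (deriv m) := (smooth_deriv g.smooth).continuous
theorem c2 (g : Good m t₀) : Continuous (deriv (deriv m)) :=
  (smooth_deriv (smooth_deriv g.smooth)).continuous

theorem abs_eq (g : Good m t₀) (t : ℝ) : m |t| = m t := by
  rcases abs_cases t with h | h <;> rw [h.1]
  exact g.even t

theorem anti (g : Good m t₀) : StrictAntiOn m (Icc 0 t₀) := by
  apply strictAntiOn_of_deriv_neg (convex_Icc 0 t₀) g.c0.continuousOn
  intro x hx
  rw [interior_Icc] at hx
  exact g.neg x hx

theorem mono (g : Good m t₀) : MonotoneOn m (Ici t₀) := by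
  apply monotoneOn_of_deriv_nonneg (convex_Ici t₀) g.c0.continuousOn
  · exact fun t _ => (g.d1 t).differentiableAt.differentiableWithinAt
  · intro x hx
    exact g.nonneg x (interior_subset hx)

theorem min_le (g : Good m t₀) (t : ℝ) : m t₀ ≤ m t := by
  rw [← g.abs_eq t]
  rcases le_total |t| t₀ with h | h
  · exact g.anti.antitoneOn ⟨abs_nonneg _, h⟩ ⟨g.t0pos.le, le_refl _⟩ h
  · exact g.mono self_mem_Ici h h

theorem infm_eq (g : Good m t₀) : infm m = m t₀ := by
  apply le_antisymm
  · exact ciInf_le ⟨m t₀, by rintro _ ⟨t, rfl⟩; exact g.min_le t⟩ t₀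
  · exact le_ciInf g.min_le

/-- `m t ≥ m T` for `|t| ≤ T`. -/
theorem le_of_abs (g : Good m t₀) {T t : ℝ} (hT : T ≤ t₀) (h : |t| ≤ T) : m T ≤ m t := by
  rw [← g.abs_eq t]
  exact g.anti.antitoneOn ⟨abs_nonneg _, h.trans hT⟩ ⟨(abs_nonneg _).trans h, hT⟩ h

theorem lt_of_abs (g : Good m t₀) {T t : ℝ} (hT : T ≤ t₀) (h : |t| < T) : m T < m t := by
  rw [← g.abs_eq t]
  exact g.anti ⟨abs_nonneg _, h.le.trans hT⟩ ⟨(abs_nonneg _).trans h.le, hT⟩ h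

theorem xi_eq (g : Good m t₀) {T : ℝ} (hT : T ∈ Ioo 0 t₀) : xi m (m T) = T := by
  apply IsLeast.csInf_eq
  refine ⟨⟨hT.1, rfl⟩, ?_⟩
  rintro t ⟨ht, he⟩
  by_contra h
  push Not at h
  have := g.lt_of_abs (T := T) (t := t) hT.2.le (by rwa [abs_of_pos ht])
  linarith

/-- a value in `(inf m, m u]` is `m T` with `T ∈ [u, t₀)`. -/
theorem exists_T (g : Good m t₀) {u ν : ℝ} (hut : u < t₀) (h1 : m t₀ < ν)
    (h2 : ν ≤ m u) : ∃ T, u ≤ T ∧ T < t₀ ∧ m T = ν := by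
  have := intermediate_value_Icc' hut.le g.c0.continuousOn
  obtain ⟨T, hT, he⟩ := this ⟨h1.le, h2⟩
  refine ⟨T, hT.1, lt_of_le_of_ne hT.2 ?_, he⟩
  rintro rfl
  linarith

end Good

/-- The speed of a curve. -/
def wSpeed (m : ℝ → ℝ) (c : ℝ → ℝ × ℝ) (s : ℝ) : ℝ :=
  Real.sqrt ((deriv (fun u => (c u).1) s) ^ 2 +
      (m (c s).1) ^ 2 * (deriv (fun u => (c u).2) s) ^ 2)

theorem wLength_eq (m : ℝ → ℝ) (c : ℝ → ℝ × ℝ) (a b : ℝ) :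
    wLength m c a b = ∫ s in a..b, wSpeed m c s := rfl

theorem fst_c1 {c : ℝ → ℝ × ℝ} (hc : ContDiff ℝ 1 c) : ContDiff ℝ 1 (fun u => (c u).1) :=
  contDiff_fst.comp hc
theorem snd_c1 {c : ℝ → ℝ × ℝ} (hc : ContDiff ℝ 1 c) : ContDiff ℝ 1 (fun u => (c u).2) :=
  contDiff_snd.comp hc

theorem c1_hd {x : ℝ → ℝ} (hx : ContDiff ℝ 1 x) (s : ℝ) : HasDerivAt x (deriv x s) s :=
  (hx.differentiable (by simp) s).hasDerivAt
theorem c1_cd {x : ℝ → ℝ} (hx : ContDiff ℝ 1 x) : Continuous (deriv x) :=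
  hx.continuous_deriv (by simp)

theorem wSpeed_cont {m : ℝ → ℝ} (hm : Continuous m) {c : ℝ → ℝ × ℝ} (hc : ContDiff ℝ 1 c) :
    Continuous (wSpeed m c) := by
  have h1 := c1_cd (fst_c1 hc)
  have h2 := c1_cd (snd_c1 hc)
  have h3 := (fst_c1 hc).continuous
  unfold wSpeed
  exact ((h1.pow 2).add (((hm.comp h3).pow 2).mul (h2.pow 2))).sqrt

/-- `p` and `q` are joined by a C¹ curve of length `L`. -/
def Joined' (m : ℝ → ℝ) (p q : ℝ × ℝ) (L : ℝ) : Prop :=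
  ∃ c : ℝ → ℝ × ℝ, ∃ b : ℝ, 0 ≤ b ∧ ContDiff ℝ 1 c ∧
    c 0 = p ∧ c b = q ∧ L = wLength m c 0 b

theorem Joined'.dist_le {m : ℝ → ℝ} {p q : ℝ × ℝ} {L : ℝ} (h : Joined' m p q L) :
    wDist m p q ≤ L := by
  have hb : BddBelow {L : ℝ | Joined' m p q L} := by
    refine ⟨0, ?_⟩
    rintro _ ⟨c, b, hb, _, _, _, rfl⟩
    exact intervalIntegral.integral_nonneg hb (fun s _ => Real.sqrt_nonneg _)
  exact csInf_le hb h

/-- A curve restricted to `[a,b]` joins its endpoints. -/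
theorem joined_of_curve {m : ℝ → ℝ} {c : ℝ → ℝ × ℝ} (hc : ContDiff ℝ 1 c) {a b : ℝ} (hab : a ≤ b) :
    Joined' m (c a) (c b) (wLength m c a b) := by
  refine ⟨fun s => c (s + a), b - a, by linarith, hc.comp (contDiff_id.add contDiff_const),
    by simp, by simp, ?_⟩
  have h : ∀ s, wSpeed m (fun s => c (s + a)) s = wSpeed m c (s + a) := by
    intro s
    unfold wSpeed
    rw [deriv_comp_add_const (fun u => (c u).1), deriv_comp_add_const (fun u => (c u).2)]
  rw [wLength_eq, wLength_eq]
  simp_rw [h]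
  rw [intervalIntegral.integral_comp_add_right (fun x => wSpeed m c x)]
  simp

theorem st_deriv_zero {x : ℝ} (h : x ≤ 0 ∨ 1 ≤ x) : deriv Real.smoothTransition x = 0 := by
  rcases h with h | h
  · apply IsLocalMin.deriv_eq_zero
    exact Filter.Eventually.of_forall fun y => by
      rw [Real.smoothTransition.zero_of_nonpos h]; exact Real.smoothTransition.nonneg y
  · apply IsLocalMax.deriv_eq_zero
    exact Filter.Eventually.of_forall fun y => by
      rw [Real.smoothTransition.one_of_one_le h]; exact Real.smoothTransition.le_one y

theorem Joined'.trans {m : ℝ → ℝ} (hm : Continuous m) {p q r : ℝ × ℝ} {L₁ L₂ : ℝ}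
    (h₁ : Joined' m p q L₁) (h₂ : Joined' m q r L₂) : Joined' m p r (L₁ + L₂) := by
  obtain ⟨c, b, hb, hc, hc0, hcb, rfl⟩ := h₁
  obtain ⟨d, e, he, hd, hd0, hde, rfl⟩ := h₂
  set S := Real.smoothTransition with hS
  have hSc : ContDiff ℝ 1 S := Real.smoothTransition.contDiff (n := 1)
  have hSd := c1_hd hSc
  have hSnn : ∀ s, 0 ≤ deriv S s := fun s => Real.smoothTransition.monotone.deriv_nonneg
  set k : ℝ → ℝ × ℝ := fun s => c (b * S s) + d (e * S (s - 1)) - q with hk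
  have hkc : ContDiff ℝ 1 k :=
    ((hc.comp (contDiff_const.mul hSc)).add
      (hd.comp (contDiff_const.mul (hSc.comp (contDiff_id.sub contDiff_const))))).sub contDiff_const
  have dgen : ∀ (x y : ℝ → ℝ) (z : ℝ), ContDiff ℝ 1 x → ContDiff ℝ 1 y → ∀ s,
      deriv (fun s => x (b * S s) + y (e * S (s - 1)) - z) s
        = deriv x (b * S s) * (b * deriv S s) + deriv y (e * S (s-1)) * (e * deriv S (s-1)) := by
    intro x y z hx hy s
    have e1 : HasDerivAt (fun s => x (b * S s)) (deriv x (b * S s) * (b * deriv S s)) s :=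
      (c1_hd hx (b * S s)).comp s ((hSd s).const_mul b)
    have e2 : HasDerivAt (fun s => S (s - 1)) (deriv S (s-1)) s := by
      have := (hSd (s-1)).comp s ((hasDerivAt_id s).sub_const 1)
      simpa using! this
    have e3 : HasDerivAt (fun s => y (e * S (s - 1)))
        (deriv y (e * S (s-1)) * (e * deriv S (s-1))) s :=
      (c1_hd hy (e * S (s-1))).comp s (e2.const_mul e)
    exact ((e1.add e3).sub_const z).deriv
  have k1 := dgen _ _ q.1 (fst_c1 hc) (fst_c1 hd)
  have k2 := dgen _ _ q.2 (snd_c1 hc) (snd_c1 hd)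
  have hsp1 : ∀ s ∈ uIcc (0:ℝ) 1, wSpeed m k s = (wSpeed m c ∘ (fun s => b * S s)) s * (b * deriv S s) := by
    intro s hs
    rw [uIcc_of_le zero_le_one] at hs
    have hz : S (s - 1) = 0 := Real.smoothTransition.zero_of_nonpos (by linarith [hs.2])
    have hz' : deriv S (s - 1) = 0 := st_deriv_zero (Or.inl (by linarith [hs.2]))
    have hk1 : k s = c (b * S s) := by simp [hk, hz, hd0]
    simp only [wSpeed, Function.comp]
    rw [show (fun u => (k u).1) = (fun s => (c (b * S s)).1 + (d (e * S (s - 1))).1 - q.1) from rfl,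
      show (fun u => (k u).2) = (fun s => (c (b * S s)).2 + (d (e * S (s - 1))).2 - q.2) from rfl,
      k1, k2, hk1, hz']
    rw [← Real.sqrt_sq (mul_nonneg hb (hSnn s)), ← Real.sqrt_mul' _ (sq_nonneg _)]
    rw [Real.sqrt_sq (mul_nonneg hb (hSnn s))]
    congr 1; ring
  have hsp2 : ∀ s ∈ uIcc (1:ℝ) 2, wSpeed m k s
      = (wSpeed m d ∘ (fun s => e * S (s-1))) s * (e * deriv S (s-1)) := by
    intro s hs
    rw [uIcc_of_le one_le_two] at hs
    have hz : S s = 1 := Real.smoothTransition.one_of_one_le (by linarith [hs.1])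
    have hz' : deriv S s = 0 := st_deriv_zero (Or.inr (by linarith [hs.1]))
    have hk1 : k s = d (e * S (s-1)) := by simp [hk, hz, hcb]
    simp only [wSpeed, Function.comp]
    rw [show (fun u => (k u).1) = (fun s => (c (b * S s)).1 + (d (e * S (s - 1))).1 - q.1) from rfl,
      show (fun u => (k u).2) = (fun s => (c (b * S s)).2 + (d (e * S (s - 1))).2 - q.2) from rfl,
      k1, k2, hk1, hz']
    rw [← Real.sqrt_sq (mul_nonneg he (hSnn (s-1))), ← Real.sqrt_mul' _ (sq_nonneg _)]
    rw [Real.sqrt_sq (mul_nonneg he (hSnn (s-1)))]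
    congr 1; ring
  refine ⟨k, 2, by norm_num, hkc, ?_, ?_, ?_⟩
  · have h1 : S 0 = 0 := Real.smoothTransition.zero
    have h2 : S (-1) = 0 := Real.smoothTransition.zero_of_nonpos (by norm_num)
    simp [hk, h1, h2, hc0, hd0]
  · have h1 : S 2 = 1 := Real.smoothTransition.one_of_one_le (by norm_num)
    have h2 : S (2 - 1) = 1 := Real.smoothTransition.one_of_one_le (by norm_num)
    simp only [hk]
    rw [h1, h2, mul_one, mul_one, hcb, hde]; simp
  · have hcont := wSpeed_cont hm hkc
    rw [wLength_eq m k, ← intervalIntegral.integral_add_adjacent_intervals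
      (hcont.intervalIntegrable 0 1) (hcont.intervalIntegrable 1 2),
      intervalIntegral.integral_congr hsp1, intervalIntegral.integral_congr hsp2,
      intervalIntegral.integral_comp_mul_deriv (f := fun s => b * S s)
        (fun s _ => (hSd s).const_mul b) ((continuous_const.mul (c1_cd hSc)).continuousOn)
        (wSpeed_cont hm hc),
      intervalIntegral.integral_comp_mul_deriv (f := fun s => e * S (s - 1))
        (f' := fun s => e * deriv S (s - 1)) ?_
        ((continuous_const.mul ((c1_cd hSc).comp (continuous_id.sub continuous_const))).continuousOn)
        (wSpeed_cont hm hd)]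
    · have h1 : S 0 = 0 := Real.smoothTransition.zero
      have h2 : S 1 = 1 := Real.smoothTransition.one
      have h3 : S (2 - 1) = 1 := Real.smoothTransition.one_of_one_le (by norm_num)
      have h4 : S (1 - 1) = 0 := Real.smoothTransition.zero_of_nonpos (by norm_num)
      simp only [h1, h2, h3, h4, mul_zero, mul_one]
      rfl
    · intro s _
      have := (hSd (s-1)).comp s ((hasDerivAt_id s).sub_const 1)
      have e2 : HasDerivAt (fun s => S (s - 1)) (deriv S (s-1)) s := by simpa using! this
      exact e2.const_mul e

/-- `√(1 - ν²/m²)` -/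
def Gf (m : ℝ → ℝ) (ν t : ℝ) : ℝ := Real.sqrt (1 - ν ^ 2 / m t ^ 2)

/-- primitive of `Gf` -/
def GG (m : ℝ → ℝ) (ν t : ℝ) : ℝ := ∫ r in (0:ℝ)..t, Gf m ν r

namespace Good
variable {m : ℝ → ℝ} {t₀ : ℝ}

theorem Gf_cont (g : Good m t₀) (ν : ℝ) : Continuous (Gf m ν) :=
  (continuous_const.sub (continuous_const.div (g.c0.pow 2)
    (fun t => (pow_pos (g.pos t) 2).ne'))).sqrt

theorem GG_hd (g : Good m t₀) (ν t : ℝ) : HasDerivAt (GG m ν) (Gf m ν t) t :=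
  intervalIntegral.integral_hasDerivAt_right ((g.Gf_cont ν).intervalIntegrable _ _)
    ((g.Gf_cont ν).stronglyMeasurableAtFilter _ _) (g.Gf_cont ν).continuousAt

theorem Gf_even (g : Good m t₀) (ν t : ℝ) : Gf m ν (-t) = Gf m ν t := by
  unfold Gf; rw [g.even]

theorem GG_odd (g : Good m t₀) (ν t : ℝ) : GG m ν (-t) = - GG m ν t := by
  unfold GG
  have := intervalIntegral.integral_comp_neg (f := Gf m ν) (a := 0) (b := t)
  simp_rw [g.Gf_even] at this
  rw [this, neg_zero, intervalIntegral.integral_symm (-t) 0]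

theorem GG_mono (g : Good m t₀) (ν : ℝ) : Monotone (GG m ν) :=
  monotone_of_deriv_nonneg (fun t => (g.GG_hd ν t).differentiableAt)
    (fun t => by rw [(g.GG_hd ν t).deriv]; exact Real.sqrt_nonneg _)

theorem seg_lower (g : Good m t₀) {c : ℝ → ℝ × ℝ} (hc : ContDiff ℝ 1 c) {a b : ℝ} (hab : a ≤ b)
    {ν : ℝ} (hν : 0 < ν) (hle : ∀ s ∈ Icc a b, ν ≤ m (c s).1) {ε : ℝ} (hε : ε ^ 2 = 1) :
    ν * ((c b).2 - (c a).2) + ε * (GG m ν (c b).1 - GG m ν (c a).1) ≤ wLength m c a b := by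
  set x := fun u => (c u).1 with hx
  set y := fun u => (c u).2 with hy
  have hxc := fst_c1 hc
  have hyc := snd_c1 hc
  have hder : ∀ s, HasDerivAt (fun s => ν * y s + ε * GG m ν (x s))
      (ν * deriv y s + ε * (Gf m ν (x s) * deriv x s)) s := by
    intro s
    exact ((c1_hd hyc s).const_mul ν).add (((g.GG_hd ν (x s)).comp s (c1_hd hxc s)).const_mul ε)
  have hcont : Continuous (fun s => ν * deriv y s + ε * (Gf m ν (x s) * deriv x s)) :=
    (continuous_const.mul (c1_cd hyc)).add
      (continuous_const.mul (((g.Gf_cont ν).comp hxc.continuous).mul (c1_cd hxc)))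
  have h1 := intervalIntegral.integral_eq_sub_of_hasDerivAt (a := a) (b := b)
    (fun s _ => hder s) (hcont.intervalIntegrable _ _)
  calc ν * ((c b).2 - (c a).2) + ε * (GG m ν (c b).1 - GG m ν (c a).1)
      = ∫ s in a..b, (ν * deriv y s + ε * (Gf m ν (x s) * deriv x s)) := by
        rw [h1]; simp only [hx, hy]; ring
    _ ≤ ∫ s in a..b, wSpeed m c s := by
        apply intervalIntegral.integral_mono_on hab (hcont.intervalIntegrable _ _)
          ((wSpeed_cont g.c0 hc).intervalIntegrable _ _)
        intro s hs
        apply Real.le_sqrt_of_sq_le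
        have hm0 := g.pos (c s).1
        have hG : Gf m ν (x s) ^ 2 = 1 - ν ^ 2 / m (c s).1 ^ 2 := by
          unfold Gf
          rw [Real.sq_sqrt]
          rw [sub_nonneg, div_le_one (by positivity)]
          exact pow_le_pow_left₀ hν.le (hle s hs) 2
        set M := m (c s).1
        set G := Gf m ν (x s)
        set X := deriv x s
        set Y := deriv y s
        change (ν * Y + ε * (G * X)) ^ 2 ≤ X ^ 2 + M ^ 2 * Y ^ 2
        have key : X ^ 2 + M ^ 2 * Y ^ 2 - (ν * Y + ε * (G * X)) ^ 2
            = (ε * X * (ν / M) - G * (M * Y)) ^ 2 := by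
          have hM : M ≠ 0 := hm0.ne'
          have e1 : ν ^ 2 = M ^ 2 * (1 - G ^ 2) := by rw [hG]; field_simp; ring
          have e2 : (ν / M) ^ 2 = 1 - G ^ 2 := by rw [div_pow, hG]; ring
          have e3 : ν / M * M = ν := by field_simp
          calc _ = X ^ 2 + M ^ 2 * Y ^ 2 - (ν ^ 2 * Y ^ 2 + 2 * ν * Y * ε * G * X
                    + ε ^ 2 * G ^ 2 * X ^ 2) := by ring
            _ = X ^ 2 + M ^ 2 * Y ^ 2 - (M ^ 2 * (1 - G ^ 2) * Y ^ 2 + 2 * (ν / M * M) * Y * ε * G * X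
                    + 1 * G ^ 2 * X ^ 2) := by rw [e1, hε, e3]
            _ = ε ^ 2 * X ^ 2 * (ν / M) ^ 2 - 2 * ε * X * (ν / M) * G * (M * Y)
                  + G ^ 2 * (M * Y) ^ 2 := by rw [hε, e2]; ring
            _ = _ := by ring
        nlinarith [sq_nonneg (ε * X * (ν / M) - G * (M * Y))]

/-- The basic lower bound for the length of curves. -/
theorem length_lower (g : Good m t₀) {u θ : ℝ} (hu : 0 < u) (hut : u < t₀)
    {c : ℝ → ℝ × ℝ} (hc : ContDiff ℝ 1 c) {b : ℝ} (hb : 0 ≤ b) (h0 : c 0 = (-u, 0))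
    (h1 : c b = (u, θ)) :
    ∃ T, u ≤ T ∧ T ≤ t₀ ∧ m T * θ + 2 * GG m (m T) T ≤ wLength m c 0 b := by
  have hxc : Continuous (fun s => |(c s).1|) := (fst_c1 hc).continuous.abs
  obtain ⟨s, hs, hmax⟩ := isCompact_Icc.exists_isMaxOn (nonempty_Icc.2 hb) hxc.continuousOn
  set A := |(c s).1| with hA
  have hmax' : ∀ r ∈ Icc 0 b, |(c r).1| ≤ A := fun r hr => hmax hr
  have huA : u ≤ A := by
    have := hmax' 0 ⟨le_refl _, hb⟩
    rwa [h0, abs_neg, abs_of_pos hu] at this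
  set T := min A t₀ with hT
  have hTt : T ≤ t₀ := min_le_right _ _
  have huT : u ≤ T := le_min huA hut.le
  refine ⟨T, huT, hTt, ?_⟩
  set ν := m T with hν
  have hle : ∀ r ∈ Icc 0 b, ν ≤ m (c r).1 := by
    intro r hr
    rcases le_total A t₀ with h | h
    · have : T = A := min_eq_left h
      exact g.le_of_abs hTt (by rw [this]; exact hmax' r hr)
    · have : T = t₀ := min_eq_right h
      rw [hν, this]; exact g.min_le _
  have hc1 := (wSpeed_cont g.c0 hc)
  have hsplit : wLength m c 0 b = wLength m c 0 s + wLength m c s b := by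
    simp only [wLength_eq]
    rw [intervalIntegral.integral_add_adjacent_intervals (hc1.intervalIntegrable _ _)
      (hc1.intervalIntegrable _ _)]
  have hGT : GG m ν T ≤ GG m ν A := g.GG_mono ν (min_le_left _ _)
  have hodd := g.GG_odd ν
  have e0 : (c 0).1 = -u := by rw [h0]
  have e0' : (c 0).2 = 0 := by rw [h0]
  have e1 : (c b).1 = u := by rw [h1]
  have e1' : (c b).2 = θ := by rw [h1]
  rcases abs_cases (c s).1 with h | h
  · have hs1 : (c s).1 = A := h.1.symm
    have a1 := g.seg_lower hc hs.1 (g.pos T) (fun r hr => hle r ⟨hr.1, hr.2.trans hs.2⟩)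
      (ε := 1) (by norm_num)
    have a2 := g.seg_lower hc hs.2 (g.pos T) (fun r hr => hle r ⟨hs.1.trans hr.1, hr.2⟩)
      (ε := -1) (by norm_num)
    rw [e0, e0', hs1, hodd] at a1
    rw [e1, e1', hs1] at a2
    rw [hsplit]; linarith
  · have hs1 : (c s).1 = -A := by rw [hA, h.1, neg_neg]
    have a1 := g.seg_lower hc hs.1 (g.pos T) (fun r hr => hle r ⟨hr.1, hr.2.trans hs.2⟩)
      (ε := -1) (by norm_num)
    have a2 := g.seg_lower hc hs.2 (g.pos T) (fun r hr => hle r ⟨hs.1.trans hr.1, hr.2⟩)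
      (ε := 1) (by norm_num)
    rw [e0, e0', hs1, hodd, hodd] at a1
    rw [e1, e1', hs1, hodd] at a2
    rw [hsplit]; linarith

end Good

/-- `√(1/m² - 1/m(0)²)`. -/
def Pf (m : ℝ → ℝ) (t : ℝ) : ℝ := Real.sqrt ((m t ^ 2)⁻¹ - (m 0 ^ 2)⁻¹)

/-- `√(m(0)² - m²)/(-m')`. -/
def Rf (m : ℝ → ℝ) (t : ℝ) : ℝ := Real.sqrt (m 0 ^ 2 - m t ^ 2) / (-deriv m t)

/-- inverse of `Pf`. -/
def Qf (m : ℝ → ℝ) (t₀ : ℝ) : ℝ → ℝ := Function.invFunOn (Pf m) (Icc 0 t₀)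

namespace Good
variable {m : ℝ → ℝ} {t₀ : ℝ}

theorem lt_m0 (g : Good m t₀) {t : ℝ} (ht : t ∈ Ioc 0 t₀) : m t < m 0 :=
  g.anti ⟨le_refl _, g.t0pos.le⟩ ⟨ht.1.le, ht.2⟩ ht.1

theorem sq_lt (g : Good m t₀) {s t : ℝ} (h : m s < m t) : m s ^ 2 < m t ^ 2 :=
  pow_lt_pow_left₀ h (g.pos s).le (by norm_num)

theorem Rf_nonneg (g : Good m t₀) {t : ℝ} (ht : t ∈ Ioo 0 t₀) : 0 ≤ Rf m t :=
  div_nonneg (Real.sqrt_nonneg _) (by linarith [g.neg t ht])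

theorem Rf_mono (g : Good m t₀) : MonotoneOn (Rf m) (Ioo 0 t₀) := by
  have h1 : MonotoneOn (fun t => (m 0 ^ 2 - m t ^ 2) / (deriv m t) ^ 2) (Ioo 0 t₀) := by
    have hd : ∀ t ∈ Ioo 0 t₀, HasDerivAt (fun t => (m 0 ^ 2 - m t ^ 2) / (deriv m t) ^ 2)
        (((-(2 * m t * deriv m t)) * (deriv m t) ^ 2 -
          (m 0 ^ 2 - m t ^ 2) * (2 * deriv m t * deriv (deriv m) t)) / ((deriv m t) ^ 2) ^ 2) t := by
      intro t ht
      have hne : (deriv m t) ^ 2 ≠ 0 := pow_ne_zero 2 (g.neg t ht).ne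
      have := (((g.d1 t).pow 2).const_sub (m 0 ^ 2)).div ((g.d2 t).pow 2) hne
      exact HasDerivAt.congr_deriv this (by simp)
    apply monotoneOn_of_deriv_nonneg (convex_Ioo 0 t₀)
    · exact fun t ht => (hd t ht).continuousAt.continuousWithinAt
    · exact fun t ht => (hd t (interior_subset ht)).differentiableAt.differentiableWithinAt
    · intro t ht
      have ht' := interior_subset ht
      rw [(hd t ht').deriv]
      apply div_nonneg _ (by positivity)
      have h2 := g.Kineq t ht'
      have h3 := g.neg t ht'
      nlinarith
  have h2 : ∀ t ∈ Ioo 0 t₀, Rf m t = Real.sqrt ((m 0 ^ 2 - m t ^ 2) / (deriv m t) ^ 2) := by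
    intro t ht
    have h3 := g.neg t ht
    rw [Real.sqrt_div' _ (sq_nonneg _), Real.sqrt_sq_eq_abs, abs_of_neg h3]; rfl
  intro s hs t ht hst
  rw [h2 s hs, h2 t ht]
  exact Real.sqrt_le_sqrt (h1 hs ht hst)

theorem Rf_cont (g : Good m t₀) : ContinuousOn (Rf m) (Ioo 0 t₀) := by
  apply ContinuousOn.div
  · exact ((continuous_const.sub (g.c0.pow 2)).sqrt).continuousOn
  · exact g.c1.neg.continuousOn
  · intro t ht; have := g.neg t ht; linarith

theorem Pf_cont (g : Good m t₀) : Continuous (Pf m) := by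
  have : Continuous (fun t => (m t ^ 2)⁻¹) :=
    (g.c0.pow 2).inv₀ (fun t => (pow_pos (g.pos t) 2).ne')
  exact (this.sub continuous_const).sqrt

theorem Pf_mono (g : Good m t₀) : StrictMonoOn (Pf m) (Icc 0 t₀) := by
  intro s hs t ht hst
  apply Real.sqrt_lt_sqrt
  · rw [sub_nonneg]
    apply inv_anti₀ (pow_pos (g.pos s) 2)
    exact pow_le_pow_left₀ (g.pos _).le
      (g.anti.antitoneOn ⟨le_refl _, g.t0pos.le⟩ hs hs.1) 2
  · apply sub_lt_sub_right
    exact inv_strictAnti₀ (pow_pos (g.pos t) 2) (g.sq_lt (g.anti hs ht hst))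

theorem Pf_zero (m : ℝ → ℝ) : Pf m 0 = 0 := by simp [Pf]

theorem Pf_pos (g : Good m t₀) {t : ℝ} (ht : t ∈ Ioc 0 t₀) : 0 < Pf m t := by
  have := g.Pf_mono ⟨le_refl _, g.t0pos.le⟩ ⟨ht.1.le, ht.2⟩ ht.1
  rwa [Pf_zero] at this

theorem Qf_P (g : Good m t₀) {t : ℝ} (ht : t ∈ Icc 0 t₀) : Qf m t₀ (Pf m t) = t :=
  g.Pf_mono.injOn.leftInvOn_invFunOn ht

theorem exists_P (g : Good m t₀) {x : ℝ} (hx : x ∈ Ioo 0 (Pf m t₀)) :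
    ∃ t ∈ Ioo 0 t₀, Pf m t = x := by
  have := intermediate_value_Ioo g.t0pos.le g.Pf_cont.continuousOn
  rw [Pf_zero] at this
  exact this hx

theorem Qf_mem (g : Good m t₀) {x : ℝ} (hx : x ∈ Ioo 0 (Pf m t₀)) : Qf m t₀ x ∈ Ioo 0 t₀ := by
  obtain ⟨t, ht, rfl⟩ := g.exists_P hx
  rwa [g.Qf_P (Ioo_subset_Icc_self ht)]

theorem Pf_mem (g : Good m t₀) {t : ℝ} (ht : t ∈ Ioo 0 t₀) : Pf m t ∈ Ioo 0 (Pf m t₀) :=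
  ⟨g.Pf_pos ⟨ht.1, ht.2.le⟩, g.Pf_mono (Ioo_subset_Icc_self ht) ⟨g.t0pos.le, le_refl _⟩ ht.2⟩

theorem Qf_mono (g : Good m t₀) : MonotoneOn (Qf m t₀) (Ioo 0 (Pf m t₀)) := by
  intro x hx y hy hxy
  obtain ⟨s, hs, rfl⟩ := g.exists_P hx
  obtain ⟨t, ht, rfl⟩ := g.exists_P hy
  rw [g.Qf_P (Ioo_subset_Icc_self hs), g.Qf_P (Ioo_subset_Icc_self ht)]
  exact (g.Pf_mono.le_iff_le (Ioo_subset_Icc_self hs) (Ioo_subset_Icc_self ht)).1 hxy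

theorem Qf_cont (g : Good m t₀) : ContinuousOn (Qf m t₀) (Ioo 0 (Pf m t₀)) := by
  intro x hx
  apply ContinuousAt.continuousWithinAt
  apply continuousAt_of_monotoneOn_of_image_mem_nhds g.Qf_mono (isOpen_Ioo.mem_nhds hx)
  have : Qf m t₀ '' Ioo 0 (Pf m t₀) = Ioo 0 t₀ := by
    ext t; constructor
    · rintro ⟨x, hx, rfl⟩; exact g.Qf_mem hx
    · intro ht; exact ⟨Pf m t, g.Pf_mem ht, g.Qf_P (Ioo_subset_Icc_self ht)⟩
  rw [this]
  exact isOpen_Ioo.mem_nhds (g.Qf_mem hx)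

end Good

/-- `Rf ∘ Qf`. -/
def RQ (m : ℝ → ℝ) (t₀ x : ℝ) : ℝ := Rf m (Qf m t₀ x)

namespace Good
variable {m : ℝ → ℝ} {t₀ : ℝ}

theorem RQ_mono (g : Good m t₀) : MonotoneOn (RQ m t₀) (Ioo 0 (Pf m t₀)) :=
  g.Rf_mono.comp g.Qf_mono (fun _ hx => g.Qf_mem hx)
theorem RQ_cont (g : Good m t₀) : ContinuousOn (RQ m t₀) (Ioo 0 (Pf m t₀)) :=
  g.Rf_cont.comp g.Qf_cont (fun _ hx => g.Qf_mem hx)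
theorem RQ_nonneg (g : Good m t₀) {x : ℝ} (hx : x ∈ Ioo 0 (Pf m t₀)) : 0 ≤ RQ m t₀ x :=
  g.Rf_nonneg (g.Qf_mem hx)

theorem sin_mem (g : Good m t₀) {T y : ℝ} (hT : T ∈ Ioo 0 t₀) (hy : y ∈ Ioc 0 (π / 2)) :
    Pf m T * sin y ∈ Ioo 0 (Pf m t₀) ∧ Pf m T * sin y ≤ Pf m T := by
  have hP := g.Pf_mem hT
  have h1 : 0 < sin y := sin_pos_of_pos_of_lt_pi hy.1 (by linarith [hy.2, pi_pos])
  have h2 := sin_le_one y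
  have h3 : Pf m T * sin y ≤ Pf m T := by nlinarith [hP.1]
  exact ⟨⟨mul_pos hP.1 h1, h3.trans_lt hP.2⟩, h3⟩

theorem RQ_int (g : Good m t₀) {T : ℝ} (hT : T ∈ Ioo 0 t₀) :
    IntervalIntegrable (fun y => RQ m t₀ (Pf m T * sin y)) MeasureTheory.volume 0 (π / 2) := by
  have hpi : (0:ℝ) ≤ π / 2 := by positivity
  rw [intervalIntegrable_iff_integrableOn_Ioc_of_le hpi]
  refine MeasureTheory.IntegrableOn.of_bound (C := RQ m t₀ (Pf m T)) (by simp) ?_ ?_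
  · apply ContinuousOn.aestronglyMeasurable _ measurableSet_Ioc
    exact g.RQ_cont.comp (continuous_const.mul continuous_sin).continuousOn
      (fun y hy => (g.sin_mem hT hy).1)
  · rw [MeasureTheory.ae_restrict_iff' measurableSet_Ioc]
    refine Filter.Eventually.of_forall fun y hy => ?_
    have h := g.sin_mem hT hy
    rw [Real.norm_of_nonneg (g.RQ_nonneg h.1)]
    exact g.RQ_mono h.1 (g.Pf_mem hT) h.2

/-- the integrand in `φ`. -/
theorem cov (g : Good m t₀) {T : ℝ} (hT : T ∈ Ioo 0 t₀) :
    IntervalIntegrable (fun t => m T / (m t * Real.sqrt ((m t) ^ 2 - m T ^ 2)))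
      MeasureTheory.volume 0 T ∧
    ∫ t in (0:ℝ)..T, m T / (m t * Real.sqrt ((m t) ^ 2 - m T ^ 2))
      = ∫ y in (0:ℝ)..(π / 2), RQ m t₀ (Pf m T * sin y) / m 0 := by
  have hPT := g.Pf_mem hT
  set f : ℝ → ℝ := fun t => arcsin (Pf m t / Pf m T) with hf
  set f' : ℝ → ℝ := fun t => -deriv m t * m 0 * m T /
    (m t * (Real.sqrt (m 0 ^ 2 - m t ^ 2) * Real.sqrt (m t ^ 2 - m T ^ 2))) with hf'
  set q : ℝ → ℝ := fun y => RQ m t₀ (Pf m T * sin y) / m 0 with hq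
  have hmem : ∀ t ∈ Ioo 0 T, t ∈ Ioo 0 t₀ := fun t ht => ⟨ht.1, ht.2.trans hT.2⟩
  have hfc : ContinuousOn f (uIcc 0 T) :=
    (continuous_arcsin.comp (g.Pf_cont.div_const _)).continuousOn
  have hmin : min 0 T = 0 := min_eq_left hT.1.le
  have hmax : max 0 T = T := max_eq_right hT.1.le
  have hd : ∀ t ∈ Ioo 0 T, HasDerivAt f (f' t) t := by
    intro t ht
    have hPt := g.Pf_mem (hmem t ht)
    have hlt := g.Pf_mono (Ioo_subset_Icc_self (hmem t ht)) (Ioo_subset_Icc_self hT) ht.2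
    have m1 := g.pos t
    have m0 := g.pos 0
    have mT := g.pos T
    have a1 : 0 < m 0 ^ 2 - m t ^ 2 :=
      sub_pos.2 (g.sq_lt (g.lt_m0 ⟨ht.1, (hmem t ht).2.le⟩))
    have a2 : 0 < m t ^ 2 - m T ^ 2 := sub_pos.2 (g.sq_lt
      (g.anti (Ioo_subset_Icc_self (hmem t ht)) (Ioo_subset_Icc_self hT) ht.2))
    have a3 : 0 < m 0 ^ 2 - m T ^ 2 := sub_pos.2 (g.sq_lt (g.lt_m0 ⟨hT.1, hT.2.le⟩))
    have e1 : (m t ^ 2)⁻¹ - (m 0 ^ 2)⁻¹ = (m 0 ^ 2 - m t ^ 2) / (m t * m 0) ^ 2 := by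
      field_simp
    have e2 : (m T ^ 2)⁻¹ - (m 0 ^ 2)⁻¹ = (m 0 ^ 2 - m T ^ 2) / (m T * m 0) ^ 2 := by
      field_simp
    have p1 : Pf m t = Real.sqrt (m 0 ^ 2 - m t ^ 2) / (m t * m 0) := by
      rw [Pf, e1, Real.sqrt_div a1.le, Real.sqrt_sq (by positivity)]
    have hdP : HasDerivAt (Pf m)
        ((-(2 * m t * deriv m t) / (m t ^ 2) ^ 2) / (2 * Pf m t)) t := by
      have h := ((((g.d1 t).pow 2).inv (pow_pos m1 2).ne').sub_const ((m 0 ^ 2)⁻¹)).sqrt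
        (by change (m t ^ 2)⁻¹ - (m 0 ^ 2)⁻¹ ≠ 0; rw [e1]; positivity)
      exact HasDerivAt.congr_deriv h (by simp [Pf])
    have hx1 : Pf m t / Pf m T < 1 := (div_lt_one hPT.1).2 hlt
    have hx0 : 0 < Pf m t / Pf m T := div_pos hPt.1 hPT.1
    have h := (hasDerivAt_arcsin (by linarith) hx1.ne).comp t (hdP.div_const (Pf m T))
    refine HasDerivAt.congr_deriv h ?_
    have e3 : 1 - (Pf m t / Pf m T) ^ 2
        = (m t ^ 2 - m T ^ 2) / (m t * m T * Pf m T) ^ 2 := by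
      have hsq : Pf m T ^ 2 = (m 0 ^ 2 - m T ^ 2) / (m T * m 0) ^ 2 := by
        rw [Pf, Real.sq_sqrt (by rw [e2]; positivity), e2]
      have hsq' : Pf m t ^ 2 = (m 0 ^ 2 - m t ^ 2) / (m t * m 0) ^ 2 := by
        rw [Pf, Real.sq_sqrt (by rw [e1]; positivity), e1]
      rw [div_pow, mul_pow, hsq, hsq']
      field_simp
      ring
    have hP := hPT.1
    rw [e3, Real.sqrt_div a2.le, Real.sqrt_sq (by positivity), p1, hf']
    have b1 := Real.sqrt_pos.2 a1
    have b2 := Real.sqrt_pos.2 a2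
    field_simp
  have hnn : ∀ t ∈ Ioo 0 T, 0 ≤ f' t := by
    intro t ht
    have h1 := g.neg t (hmem t ht)
    have m1 := g.pos t
    have m0 := g.pos 0
    have mT := g.pos T
    apply div_nonneg
    · have : 0 < -deriv m t := by linarith
      positivity
    · positivity
  have heq : ∀ t ∈ Ioo 0 T, (q ∘ f) t * f' t
      = m T / (m t * Real.sqrt ((m t) ^ 2 - m T ^ 2)) := by
    intro t ht
    have hPt := g.Pf_mem (hmem t ht)
    have hlt := g.Pf_mono (Ioo_subset_Icc_self (hmem t ht)) (Ioo_subset_Icc_self hT) ht.2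
    have hx1 : Pf m t / Pf m T < 1 := (div_lt_one hPT.1).2 hlt
    have hx0 : 0 < Pf m t / Pf m T := div_pos hPt.1 hPT.1
    have a1 : 0 < m 0 ^ 2 - m t ^ 2 :=
      sub_pos.2 (g.sq_lt (g.lt_m0 ⟨ht.1, (hmem t ht).2.le⟩))
    have a2 : 0 < m t ^ 2 - m T ^ 2 := sub_pos.2 (g.sq_lt
      (g.anti (Ioo_subset_Icc_self (hmem t ht)) (Ioo_subset_Icc_self hT) ht.2))
    have m1 := g.pos t
    have m0 := g.pos 0
    have hneg := (g.neg t (hmem t ht)).ne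
    simp only [hq, hf, Function.comp]
    rw [sin_arcsin (by linarith) hx1.le, mul_div_cancel₀ _ hPT.1.ne', RQ,
      g.Qf_P (Ioo_subset_Icc_self (hmem t ht)), Rf, hf']
    have b1 := Real.sqrt_pos.2 a1
    have b2 := Real.sqrt_pos.2 a2
    field_simp
  have hf0 : f 0 = 0 := by simp [hf, Pf_zero]
  have hfT : f T = π / 2 := by simp [hf, div_self hPT.1.ne']
  have hcov := intervalIntegral.integral_comp_mul_deriv_of_deriv_nonneg (f := f) (f' := f') (g := q)
    hfc (by rwa [hmin, hmax]) (by rwa [hmin, hmax])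
  have hintg := (intervalIntegral.integrable_comp_mul_deriv_iff_of_deriv_nonneg (f := f) (f' := f')
    (g := q) hfc (by rwa [hmin, hmax]) (by rwa [hmin, hmax])).2
    (by rw [hf0, hfT]; exact (g.RQ_int hT).div_const _)
  rw [hf0, hfT] at hcov
  constructor
  · rw [intervalIntegrable_iff_integrableOn_Ioo_of_le hT.1.le] at hintg ⊢
    exact hintg.congr_fun heq measurableSet_Ioo
  · rw [← hcov, intervalIntegral.integral_of_le hT.1.le, intervalIntegral.integral_of_le hT.1.le,
      MeasureTheory.integral_Ioc_eq_integral_Ioo, MeasureTheory.integral_Ioc_eq_integral_Ioo]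
    exact (MeasureTheory.setIntegral_congr_fun measurableSet_Ioo heq).symm

theorem phi_eq (g : Good m t₀) {T : ℝ} (hT : T ∈ Ioo 0 t₀) :
    phi m (m T) = 2 * ∫ y in (0:ℝ)..(π / 2), RQ m t₀ (Pf m T * sin y) / m 0 := by
  rw [phi, g.xi_eq hT, (g.cov hT).2]

theorem phi_mono (g : Good m t₀) {T T' : ℝ} (hT : T ∈ Ioo 0 t₀) (hT' : T' ∈ Ioo 0 t₀)
    (h : T ≤ T') : phi m (m T) ≤ phi m (m T') := by
  rw [g.phi_eq hT, g.phi_eq hT']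
  apply mul_le_mul_of_nonneg_left _ (by norm_num)
  apply intervalIntegral.integral_mono_on_of_le_Ioo (by positivity)
    ((g.RQ_int hT).div_const _) ((g.RQ_int hT').div_const _)
  intro y hy
  have hy' : y ∈ Ioc 0 (π / 2) := Ioo_subset_Ioc_self hy
  apply div_le_div_of_nonneg_right _ (g.pos 0).le
  apply g.RQ_mono (g.sin_mem hT hy').1 (g.sin_mem hT' hy').1
  apply mul_le_mul_of_nonneg_right _
    (sin_nonneg_of_nonneg_of_le_pi hy.1.le (by linarith [hy.2, pi_pos]))
  exact g.Pf_mono.monotoneOn (Ioo_subset_Icc_self hT) (Ioo_subset_Icc_self hT') h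

theorem phi_cont (g : Good m t₀) : ContinuousOn (fun T => phi m (m T)) (Ioo 0 t₀) := by
  intro T hT
  obtain ⟨B, hB1, hB2⟩ := exists_between hT.2
  have hB : B ∈ Ioo 0 t₀ := ⟨hT.1.trans hB1, hB2⟩
  have hnhds : Ioo 0 B ∈ nhds T := isOpen_Ioo.mem_nhds ⟨hT.1, hB1⟩
  have key : ContinuousAt (fun T => ∫ y in (0:ℝ)..(π / 2), RQ m t₀ (Pf m T * sin y) / m 0) T := by
    apply intervalIntegral.continuousAt_of_dominated_interval
      (bound := fun _ => RQ m t₀ (Pf m B) / m 0)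
    · filter_upwards [hnhds] with x hx
      have hx' : x ∈ Ioo 0 t₀ := ⟨hx.1, hx.2.trans hB2⟩
      have := ((g.RQ_int hx').div_const (m 0)).aestronglyMeasurable
      rwa [uIoc_of_le (by positivity)]
    · filter_upwards [hnhds] with x hx
      have hx' : x ∈ Ioo 0 t₀ := ⟨hx.1, hx.2.trans hB2⟩
      refine Filter.Eventually.of_forall fun y hy => ?_
      rw [uIoc_of_le (by positivity)] at hy
      have h := g.sin_mem hx' hy
      rw [Real.norm_of_nonneg (div_nonneg (g.RQ_nonneg h.1) (g.pos 0).le)]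
      apply div_le_div_of_nonneg_right _ (g.pos 0).le
      apply g.RQ_mono h.1 (g.Pf_mem hB) (h.2.trans _)
      exact g.Pf_mono.monotoneOn (Ioo_subset_Icc_self hx') (Ioo_subset_Icc_self hB) hx.2.le
    · exact intervalIntegrable_const
    · refine Filter.Eventually.of_forall fun y hy => ?_
      rw [uIoc_of_le (by positivity)] at hy
      have h := g.sin_mem hT hy
      have h1 : ContinuousAt (RQ m t₀) (Pf m T * sin y) :=
        g.RQ_cont.continuousAt (isOpen_Ioo.mem_nhds h.1)
      have h2 : ContinuousAt (fun x => Pf m x * sin y) T :=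
        (g.Pf_cont.mul continuous_const).continuousAt
      exact (ContinuousAt.comp (f := fun x => Pf m x * sin y) h1 h2).div_const _
  apply ContinuousAt.continuousWithinAt
  have h2 := key.const_mul 2
  apply h2.congr
  filter_upwards [isOpen_Ioo.mem_nhds hT] with x hx
  exact (g.phi_eq hx).symm

end Good

/-- the integrand of `φ`. -/
def Df (m : ℝ → ℝ) (t μ : ℝ) : ℝ := μ / (m t * Real.sqrt (m t ^ 2 - μ ^ 2))

/-- `φ` as an integral over a fixed interval. -/
def phit (m : ℝ → ℝ) (t₀ μ : ℝ) : ℝ := ∫ t in (0:ℝ)..t₀, Df m t μ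

namespace Good
variable {m : ℝ → ℝ} {t₀ : ℝ}

theorem Df_hd (g : Good m t₀) {t μ : ℝ} (hμ : 0 < μ) (hne : μ ≠ m t) :
    HasDerivAt (fun μ => - Gf m μ t) (Df m t μ) μ := by
  have hm := g.pos t
  rcases lt_or_gt_of_ne hne with h | h
  · have h1 : 0 < m t ^ 2 - μ ^ 2 := sub_pos.2 (pow_lt_pow_left₀ h hμ.le (by norm_num))
    have e1 : 1 - μ ^ 2 / m t ^ 2 = (m t ^ 2 - μ ^ 2) / m t ^ 2 := by field_simp
    have := (((((hasDerivAt_id μ).pow 2).div_const (m t ^ 2)).const_sub 1).sqrt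
      (by change 1 - μ ^ 2 / m t ^ 2 ≠ 0; rw [e1]; positivity)).neg
    refine HasDerivAt.congr_deriv this ?_
    have b1 := Real.sqrt_pos.2 h1
    simp only [Df, id, Pi.pow_apply, e1, Real.sqrt_div h1.le, Real.sqrt_sq hm.le]
    field_simp
    simp
  · have hz : Df m t μ = 0 := by
      have : m t ^ 2 - μ ^ 2 ≤ 0 := sub_nonpos.2 (pow_le_pow_left₀ hm.le h.le 2)
      rw [Df, Real.sqrt_eq_zero_of_nonpos this]; simp
    rw [hz]
    apply (hasDerivAt_const μ (0:ℝ)).congr_of_eventuallyEq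
    filter_upwards [lt_mem_nhds h] with x hx
    have : 1 - x ^ 2 / m t ^ 2 ≤ 0 := by
      rw [sub_nonpos, one_le_div (by positivity)]
      exact pow_le_pow_left₀ hm.le hx.le 2
    rw [Gf, Real.sqrt_eq_zero_of_nonpos this]; simp

theorem Df_int (g : Good m t₀) (t : ℝ) {a b : ℝ} (ha : 0 < a) (hab : a ≤ b) :
    IntervalIntegrable (Df m t) MeasureTheory.volume a b ∧
    ∫ μ in a..b, Df m t μ = Gf m a t - Gf m b t := by
  have hm := g.pos t
  have hmono : MonotoneOn (fun μ => - Gf m μ t) (uIcc a b) := by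
    rw [uIcc_of_le hab]
    intro x hx y hy hxy
    apply neg_le_neg
    apply Real.sqrt_le_sqrt
    apply sub_le_sub_left
    apply div_le_div_of_nonneg_right _ (by positivity)
    exact pow_le_pow_left₀ (ha.le.trans hx.1) hxy 2
  have hi : IntervalIntegrable (Df m t) MeasureTheory.volume a b := by
    have h1 := hmono.intervalIntegrable_deriv
    rw [intervalIntegrable_iff, uIoc_of_le hab] at h1 ⊢
    apply h1.congr
    have h2 : ∀ᵐ x : ℝ, x ≠ m t := by
      rw [MeasureTheory.ae_iff]; simp
    rw [Filter.EventuallyEq, MeasureTheory.ae_restrict_iff' measurableSet_Ioc]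
    filter_upwards [h2] with x hx hx2
    exact (g.Df_hd (ha.trans hx2.1) hx).deriv
  refine ⟨hi, ?_⟩
  have hc : Continuous (fun μ => - Gf m μ t) := by
    unfold Gf
    exact ((continuous_const.sub ((continuous_id.pow 2).div_const _)).sqrt).neg
  rw [MeasureTheory.integral_eq_of_hasDerivAt_off_countable_of_le (fun μ => - Gf m μ t) (Df m t) hab
    (countable_singleton (m t)) hc.continuousOn
    (fun x hx => g.Df_hd (ha.trans hx.1.1) hx.2) hi]
  ring

theorem Df_nonneg (g : Good m t₀) {t μ : ℝ} (hμ : 0 ≤ μ) : 0 ≤ Df m t μ :=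
  div_nonneg hμ (mul_nonneg (g.pos t).le (Real.sqrt_nonneg _))

theorem fubini (g : Good m t₀) {a b : ℝ} (ha : 0 < a) (hab : a ≤ b) :
    IntervalIntegrable (phit m t₀) MeasureTheory.volume a b ∧
    ∫ μ in a..b, phit m t₀ μ = GG m a t₀ - GG m b t₀ := by
  have hmeas : Measurable (Function.uncurry (Df m)) := by
    have h1 : Measurable (fun p : ℝ × ℝ => m p.1) := g.c0.measurable.comp measurable_fst
    exact measurable_snd.div
      (h1.mul (((h1.pow_const 2).sub (measurable_snd.pow_const 2)).sqrt))
  have hprod : MeasureTheory.Integrable (Function.uncurry (Df m))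
      ((MeasureTheory.volume.restrict (Ioc 0 t₀)).prod
        (MeasureTheory.volume.restrict (Ioc a b))) := by
    rw [MeasureTheory.integrable_prod_iff hmeas.aestronglyMeasurable]
    constructor
    · refine Filter.Eventually.of_forall fun t => ?_
      have := (g.Df_int t ha hab).1
      rwa [intervalIntegrable_iff, uIoc_of_le hab] at this
    · have h1 : (fun t => ∫ μ in Ioc a b, ‖Function.uncurry (Df m) (t, μ)‖)
          = fun t => Gf m a t - Gf m b t := by
        funext t
        rw [← (g.Df_int t ha hab).2, intervalIntegral.integral_of_le hab]
        apply MeasureTheory.setIntegral_congr_fun measurableSet_Ioc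
        intro μ hμ
        exact Real.norm_of_nonneg (g.Df_nonneg (ha.trans hμ.1).le)
      rw [h1]
      exact (((g.Gf_cont a).sub (g.Gf_cont b)).integrableOn_Icc).mono_set Ioc_subset_Icc_self
  have e1 : phit m t₀ = fun μ => ∫ t in Ioc 0 t₀, Df m t μ := by
    funext μ; rw [phit, intervalIntegral.integral_of_le g.t0pos.le]
  constructor
  · rw [intervalIntegrable_iff, uIoc_of_le hab, e1]
    exact hprod.integral_prod_right
  · rw [e1, intervalIntegral.integral_of_le hab, ← MeasureTheory.integral_integral_swap hprod]
    have : ∀ t, ∫ μ in Ioc a b, Df m t μ = Gf m a t - Gf m b t := by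
      intro t; rw [← (g.Df_int t ha hab).2, intervalIntegral.integral_of_le hab]
    simp_rw [this]
    rw [← intervalIntegral.integral_of_le g.t0pos.le,
      intervalIntegral.integral_sub ((g.Gf_cont a).intervalIntegrable _ _)
        ((g.Gf_cont b).intervalIntegrable _ _)]
    rfl

theorem phit_eq (g : Good m t₀) {T : ℝ} (hT : T ∈ Ioo 0 t₀) :
    2 * phit m t₀ (m T) = phi m (m T) := by
  have hz : ∀ t ∈ uIcc T t₀, Df m t (m T) = 0 := by
    intro t ht
    rw [uIcc_of_le hT.2.le] at ht
    have h1 : m t ≤ m T :=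
      g.anti.antitoneOn (Ioo_subset_Icc_self hT) ⟨hT.1.le.trans ht.1, ht.2⟩ ht.1
    have : m t ^ 2 - m T ^ 2 ≤ 0 := sub_nonpos.2 (pow_le_pow_left₀ (g.pos t).le h1 2)
    rw [Df, Real.sqrt_eq_zero_of_nonpos this]; simp
  have hi : IntervalIntegrable (fun t => Df m t (m T)) MeasureTheory.volume 0 T := (g.cov hT).1
  have hi2 : IntervalIntegrable (fun t => Df m t (m T)) MeasureTheory.volume T t₀ := by
    have : IntervalIntegrable (fun _ : ℝ => (0:ℝ)) MeasureTheory.volume T t₀ :=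
      intervalIntegrable_const
    apply this.congr
    intro t ht
    exact (hz t (uIoc_subset_uIcc ht)).symm
  rw [phi, g.xi_eq hT, phit, ← intervalIntegral.integral_add_adjacent_intervals hi hi2,
    intervalIntegral.integral_congr hz]
  simp [Df]

theorem GG_eq (g : Good m t₀) {T : ℝ} (hT : T ∈ Icc 0 t₀) :
    GG m (m T) t₀ = GG m (m T) T := by
  have hz : ∀ t ∈ uIcc T t₀, Gf m (m T) t = 0 := by
    intro t ht
    rw [uIcc_of_le hT.2] at ht
    have h1 : m t ≤ m T :=
      g.anti.antitoneOn hT ⟨hT.1.trans ht.1, ht.2⟩ ht.1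
    apply Real.sqrt_eq_zero_of_nonpos
    rw [sub_nonpos, one_le_div (pow_pos (g.pos t) 2)]
    exact pow_le_pow_left₀ (g.pos t).le h1 2
  rw [GG, GG, ← intervalIntegral.integral_add_adjacent_intervals
    ((g.Gf_cont _).intervalIntegrable 0 T) ((g.Gf_cont _).intervalIntegrable T t₀),
    intervalIntegral.integral_congr hz]
  simp

/-- The key inequality. -/
theorem key (g : Good m t₀) {T T' : ℝ} (hT : T ∈ Ioo 0 t₀) (hT' : T' ∈ Ioc 0 t₀) :
    m T * phi m (m T) + 2 * GG m (m T) T ≤ m T' * phi m (m T) + 2 * GG m (m T') T' := by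
  rw [← g.GG_eq (Ioo_subset_Icc_self hT), ← g.GG_eq (Ioc_subset_Icc_self hT')]
  rcases le_total T T' with h | h
  · have hle : m T' ≤ m T :=
      g.anti.antitoneOn (Ioo_subset_Icc_self hT) (Ioc_subset_Icc_self hT') h
    obtain ⟨f1, f2⟩ := g.fubini (g.pos T') hle
    have : ∫ μ in (m T')..(m T), (phi m (m T) / 2) ≤ ∫ μ in (m T')..(m T), phit m t₀ μ := by
      apply intervalIntegral.integral_mono_on_of_le_Ioo hle intervalIntegrable_const f1
      intro μ hμ
      obtain ⟨S, hS1, hS2⟩ := intermediate_value_Ioo' h g.c0.continuousOn hμ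
      have hS : S ∈ Ioo 0 t₀ := ⟨hT.1.trans hS1.1, hS1.2.trans_le hT'.2⟩
      have := g.phi_mono hT hS hS1.1.le
      rw [← g.phit_eq hS, hS2] at this
      linarith
    rw [f2, intervalIntegral.integral_const, smul_eq_mul] at this
    linarith
  · have hle : m T ≤ m T' :=
      g.anti.antitoneOn (Ioc_subset_Icc_self hT') (Ioo_subset_Icc_self hT) h
    obtain ⟨f1, f2⟩ := g.fubini (g.pos T) hle
    have : ∫ μ in (m T)..(m T'), phit m t₀ μ ≤ ∫ μ in (m T)..(m T'), (phi m (m T) / 2) := by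
      apply intervalIntegral.integral_mono_on_of_le_Ioo hle f1 intervalIntegrable_const
      intro μ hμ
      obtain ⟨S, hS1, hS2⟩ := intermediate_value_Ioo' h g.c0.continuousOn hμ
      have hS : S ∈ Ioo 0 t₀ := ⟨hT'.1.trans hS1.1, hS1.2.trans hT.2⟩
      have := g.phi_mono hS hT hS1.2.le
      rw [← g.phit_eq hS, hS2] at this
      linarith
    rw [f2, intervalIntegral.integral_const, smul_eq_mul] at this
    linarith

theorem quad (g : Good m t₀) : ∃ C > 0, ∀ t ∈ Icc 0 t₀, m t ^ 2 - m t₀ ^ 2 ≤ C ^ 2 * (t₀ - t) ^ 2 := by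
  obtain ⟨A, hA⟩ := isCompact_Icc.exists_bound_of_continuousOn (s := Icc 0 t₀) g.c2.continuousOn
  have hA0 : 0 ≤ A := (norm_nonneg _).trans (hA 0 ⟨le_refl _, g.t0pos.le⟩)
  have h1 : ∀ t ∈ Icc 0 t₀, - deriv m t ≤ A * (t₀ - t) := by
    intro t ht
    have := (convex_Icc (0:ℝ) t₀).norm_image_sub_le_of_norm_deriv_le
      (fun x _ => (g.d2 x).differentiableAt) hA ht ⟨g.t0pos.le, le_refl _⟩
    rw [g.crit, zero_sub, Real.norm_eq_abs, Real.norm_eq_abs,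
      abs_of_nonneg (sub_nonneg.2 ht.2)] at this
    exact (le_abs_self _).trans this
  set B := A * m 0 + 1 with hB
  have hm0 := g.pos 0
  have hB0 : 0 < B := by positivity
  refine ⟨Real.sqrt B, Real.sqrt_pos.2 hB0, ?_⟩
  rw [Real.sq_sqrt hB0.le]
  have hd : ∀ t, HasDerivAt (fun t => B * (t₀ - t) ^ 2 - (m t ^ 2 - m t₀ ^ 2))
      (B * (2 * (t₀ - t) * (-1)) - 2 * m t * deriv m t) t := by
    intro t
    have := ((((hasDerivAt_id t).const_sub t₀).pow 2).const_mul B).sub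
      (((g.d1 t).pow 2).sub_const (m t₀ ^ 2))
    exact HasDerivAt.congr_deriv this (by simp)
  have hanti : AntitoneOn (fun t => B * (t₀ - t) ^ 2 - (m t ^ 2 - m t₀ ^ 2)) (Icc 0 t₀) := by
    apply antitoneOn_of_deriv_nonpos (convex_Icc _ _)
    · exact fun t _ => (hd t).continuousAt.continuousWithinAt
    · exact fun t _ => (hd t).differentiableAt.differentiableWithinAt
    · intro t ht
      have ht' := interior_subset ht
      rw [(hd t).deriv]
      have h2 := h1 t ht'
      have h3 : m t ≤ m 0 := g.anti.antitoneOn ⟨le_refl _, g.t0pos.le⟩ ht' ht'.1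
      have h4 := g.pos t
      have h5 : 0 ≤ t₀ - t := sub_nonneg.2 ht'.2
      have h6 : m t * (-deriv m t) ≤ m 0 * (A * (t₀ - t)) := by
        apply (mul_le_mul_of_nonneg_left h2 h4.le).trans
        exact mul_le_mul_of_nonneg_right h3 (by positivity)
      rw [hB]; nlinarith
  intro t ht
  have := hanti ht ⟨g.t0pos.le, le_refl _⟩ ht.2
  simp at this
  linarith

theorem phi_surj (g : Good m t₀) {u θ : ℝ} (hu : 0 < u) (hut : u < t₀) (h : phi m (m u) ≤ θ) :
    ∃ T, u ≤ T ∧ T < t₀ ∧ phi m (m T) = θ := by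
  obtain ⟨C, hC, hq⟩ := g.quad
  have hm0 := g.pos 0
  have hmt := g.pos t₀
  set k := m t₀ / (m 0 * C) with hk
  have hkpos : 0 < k := by positivity
  have hlow : ∀ T ∈ Ioo 0 t₀, 2 * (k * (Real.log t₀ - Real.log (t₀ - T))) ≤ phi m (m T) := by
    intro T hT
    rw [phi, g.xi_eq hT]
    apply mul_le_mul_of_nonneg_left _ (by norm_num)
    have hd : ∀ t ∈ uIcc 0 T, HasDerivAt (fun t => - (k * Real.log (t₀ - t))) (k / (t₀ - t)) t := by
      intro t ht
      rw [uIcc_of_le hT.1.le] at ht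
      have h0 : 0 < t₀ - t := by linarith [ht.2, hT.2]
      have := ((((hasDerivAt_id t).const_sub t₀).log h0.ne').const_mul k).neg
      refine HasDerivAt.congr_deriv this ?_
      simp; field_simp
    have hi : IntervalIntegrable (fun t => k / (t₀ - t)) MeasureTheory.volume 0 T := by
      apply ContinuousOn.intervalIntegrable
      apply continuousOn_const.div (continuous_const.sub continuous_id).continuousOn
      intro t ht
      rw [uIcc_of_le hT.1.le] at ht
      have : 0 < t₀ - t := by linarith [ht.2, hT.2]
      exact this.ne'
    have e := intervalIntegral.integral_eq_sub_of_hasDerivAt hd hi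
    have e' : k * (Real.log t₀ - Real.log (t₀ - T)) = ∫ t in (0:ℝ)..T, k / (t₀ - t) := by
      rw [e]; simp; ring
    rw [e']
    apply intervalIntegral.integral_mono_on_of_le_Ioo hT.1.le hi (g.cov hT).1
    intro t ht
    have ht' : t ∈ Icc 0 t₀ := ⟨ht.1.le, (ht.2.trans hT.2).le⟩
    have a2 : 0 < m t ^ 2 - m T ^ 2 := sub_pos.2 (g.sq_lt
      (g.anti ht' (Ioo_subset_Icc_self hT) ht.2))
    have h0 : 0 < t₀ - t := by linarith [ht.2, hT.2]
    have hmT : m t₀ ≤ m T := g.min_le T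
    have hs : Real.sqrt (m t ^ 2 - m T ^ 2) ≤ C * (t₀ - t) := by
      apply Real.sqrt_le_iff.2 ⟨by positivity, ?_⟩
      have := hq t ht'
      have h2 := pow_le_pow_left₀ hmt.le hmT 2
      rw [mul_pow]; linarith
    have h3 : m t ≤ m 0 := g.anti.antitoneOn ⟨le_refl _, g.t0pos.le⟩ ht' ht.1.le
    have hmt' := g.pos t
    have b2 := Real.sqrt_pos.2 a2
    calc k / (t₀ - t) = m t₀ / (m 0 * (C * (t₀ - t))) := by rw [hk]; field_simp
      _ ≤ _ := by
        apply div_le_div₀ (g.pos T).le hmT (by positivity)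
        exact mul_le_mul h3 hs b2.le hm0.le
  -- choose `B` close to `t₀`
  set E := min (t₀ - u) (Real.exp (Real.log t₀ - |θ| / k)) with hE
  have hEpos : 0 < E := lt_min (by linarith) (Real.exp_pos _)
  set B := t₀ - E / 2 with hBdef
  have hBu : u < B := by
    have : E ≤ t₀ - u := min_le_left _ _
    rw [hBdef]; linarith
  have hBmem : B ∈ Ioo 0 t₀ := ⟨hu.trans hBu, by rw [hBdef]; linarith⟩
  have hBphi : θ ≤ phi m (m B) := by
    refine le_trans ?_ (hlow B hBmem)
    have e1 : Real.log (t₀ - B) ≤ Real.log t₀ - |θ| / k := by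
      rw [hBdef, sub_sub_cancel]
      calc Real.log (E / 2) ≤ Real.log (Real.exp (Real.log t₀ - |θ| / k)) := by
            apply Real.log_le_log (by positivity)
            have : E ≤ Real.exp (Real.log t₀ - |θ| / k) := min_le_right _ _
            linarith
        _ = _ := Real.log_exp _
    have e2 : |θ| ≤ k * (Real.log t₀ - Real.log (t₀ - B)) := by
      have : |θ| / k ≤ Real.log t₀ - Real.log (t₀ - B) := by linarith
      rw [div_le_iff₀ hkpos] at this
      linarith
    linarith [le_abs_self θ, abs_nonneg θ]
  have hcont : ContinuousOn (fun T => phi m (m T)) (Icc u B) :=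
    g.phi_cont.mono (fun x hx => ⟨hu.trans_le hx.1, hx.2.trans_lt hBmem.2⟩)
  obtain ⟨T, hT, he⟩ := intermediate_value_Icc hBu.le hcont ⟨h, hBphi⟩
  exact ⟨T, hT.1, hT.2.trans_lt hBmem.2, he⟩

/-- Every curve joining `(-u,0)` to `(u, φ(m T))` has length at least `ℓ(T)`. -/
theorem length_ge (g : Good m t₀) {u T : ℝ} (hu : 0 < u) (huT : u ≤ T) (hT : T < t₀) 
    {c : ℝ → ℝ × ℝ} (hc : ContDiff ℝ 1 c) {b : ℝ} (hb : 0 ≤ b) (h0 : c 0 = (-u, 0))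
    (h1 : c b = (u, phi m (m T))) :
    m T * phi m (m T) + 2 * GG m (m T) T ≤ wLength m c 0 b := by
  obtain ⟨T', h2, h3, h4⟩ := g.length_lower hu (huT.trans_lt hT) hc hb h0 h1
  exact (g.key ⟨hu.trans_le huT, hT⟩ ⟨hu.trans_le h2, h3⟩).trans h4

end Good

/-- the truncated force. -/
def fT (m : ℝ → ℝ) (T t : ℝ) : ℝ :=
  m T ^ 2 * deriv m (max (-T) (min t T)) / m (max (-T) (min t T)) ^ 3

/-- The canonical geodesic through the equator with Clairaut constant `m T`. -/
structure Canon (m : ℝ → ℝ) (T : ℝ) (σ v Θ : ℝ → ℝ) (h : ℝ) : Prop where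
  dσ : ∀ s, HasDerivAt σ (v s) s
  dv : ∀ s, HasDerivAt v (fT m T (σ s)) s
  dΘ : ∀ s, HasDerivAt Θ (m T / m (σ s) ^ 2) s
  σ0 : σ 0 = 0
  Θ0 : Θ 0 = 0
  energy : ∀ s, v s ^ 2 + m T ^ 2 / m (σ s) ^ 2 = 1
  bdd : ∀ s, |σ s| ≤ T
  σodd : ∀ s, σ (-s) = - σ s
  vev : ∀ s, v (-s) = v s
  Θodd : ∀ s, Θ (-s) = - Θ s
  hpos : 0 < h
  vpos : ∀ s ∈ Ico 0 h, 0 < v s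
  σh : σ h = T
  vh : v h = 0
  σrefl : ∀ s, σ (2 * h - s) = σ s
  Θrefl : ∀ s, Θ (2 * h - s) = 2 * Θ h - Θ s
  Θh : 2 * Θ h = phi m (m T)
  len : 2 * h = m T * phi m (m T) + 2 * GG m (m T) T

namespace Good
variable {m : ℝ → ℝ} {t₀ : ℝ}

theorem fT_eq {T t : ℝ} (h : |t| ≤ T) : fT m T t = m T ^ 2 * deriv m t / m t ^ 3 := by
  unfold fT; rw [clamp_of_abs_le h]

theorem fT_cont (g : Good m t₀) (T : ℝ) : Continuous (fT m T) := by
  have hc := (clamp_lip T).continuous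
  unfold fT
  exact (continuous_const.mul (g.c1.comp hc)).div ((g.c0.comp hc).pow 3)
    (fun t => (pow_pos (g.pos _) 3).ne')

theorem fT_lip (g : Good m t₀) {T : ℝ} (hT : 0 ≤ T) : ∃ K, LipschitzWith K (fT m T) := by
  have hs : ContDiff ℝ 1 (fun t => m T ^ 2 * deriv m t / m t ^ 3) := by
    have h1 : ContDiff ℝ 1 m := g.smooth.of_le (by exact_mod_cast le_top)
    have h2 : ContDiff ℝ 1 (deriv m) := (smooth_deriv g.smooth).of_le (by exact_mod_cast le_top)
    exact (contDiff_const.mul h2).div (h1.pow 3) (fun t => (pow_pos (g.pos _) 3).ne')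
  obtain ⟨K, hK⟩ := hs.contDiffOn.exists_lipschitzOnWith (s := Icc (-T) T) (by simp)
    (convex_Icc _ _) isCompact_Icc
  refine ⟨K, ?_⟩
  intro x y
  have hm : ∀ t, max (-T) (min t T) ∈ Icc (-T) T := fun t => abs_le.1 (clamp_mem hT t)
  refine (hK (hm x) (hm y)).trans ?_
  gcongr
  have := clamp_lip T x y
  simpa using this

theorem fT_bdd (g : Good m t₀) {T : ℝ} (hT : 0 ≤ T) : ∃ M, ∀ t, |fT m T t| ≤ M := by
  obtain ⟨M, hM⟩ := isCompact_Icc.exists_bound_of_continuousOn (s := Icc (-T) T)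
    (g.fT_cont T).continuousOn
  refine ⟨M, fun t => ?_⟩
  have h1 := hM _ (abs_le.1 (clamp_mem hT t))
  have : fT m T (max (-T) (min t T)) = fT m T t := by
    unfold fT; rw [clamp_of_abs_le (clamp_mem hT t)]
  rwa [this] at h1

theorem fT_odd (g : Good m t₀) {T : ℝ} (hT : 0 ≤ T) (t : ℝ) : fT m T (-t) = - fT m T t := by
  have : max (-T) (min (-t) T) = - max (-T) (min t T) := by
    rcases le_total t (-T) with h | h
    · rw [min_eq_right (by linarith), min_eq_left (by linarith), max_eq_right (by linarith),
        max_eq_left h, neg_neg]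
    · rcases le_total t T with h' | h'
      · rw [min_eq_left (by linarith), min_eq_left h', max_eq_right (by linarith), max_eq_right h]
      · rw [min_eq_left (by linarith), min_eq_right h', max_eq_left (by linarith),
          max_eq_right (by linarith)]
  unfold fT
  rw [this, deriv_zero_of_even g.even, g.even]
  ring

theorem fT_neg (g : Good m t₀) {T t : ℝ} (hT : T ∈ Ioo 0 t₀) (ht : 0 < t) : fT m T t < 0 := by
  unfold fT
  have h1 : max (-T) (min t T) = min t T := max_eq_right (by
    have := lt_min ht hT.1; linarith [hT.1])
  rw [h1]
  have h2 : min t T ∈ Ioo 0 t₀ := ⟨lt_min ht hT.1, (min_le_right _ _).trans_lt hT.2⟩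
  apply div_neg_of_neg_of_pos _ (pow_pos (g.pos _) 3)
  exact mul_neg_of_pos_of_neg (pow_pos (g.pos _) 2) (g.neg _ h2)

/-- the potential -/
theorem potential (g : Good m t₀) {T : ℝ} (hT : T ∈ Ioo 0 t₀) :
    ∃ U : ℝ → ℝ, (∀ t, HasDerivAt U (-2 * fT m T t) t) ∧
      (∀ t, |t| ≤ T → U t = m T ^ 2 / m t ^ 2) ∧ (∀ t, U t ≤ 1 → |t| ≤ T) := by
  have hc := g.fT_cont T
  set U : ℝ → ℝ := fun t => m T ^ 2 / m 0 ^ 2 + -2 * ∫ r in (0:ℝ)..t, fT m T r with hU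
  have hd : ∀ t, HasDerivAt U (-2 * fT m T t) t := by
    intro t
    exact ((intervalIntegral.integral_hasDerivAt_right (hc.intervalIntegrable _ _)
      (hc.stronglyMeasurableAtFilter _ _) hc.continuousAt).const_mul (-2)).const_add _
  have hW : ∀ t, HasDerivAt (fun t => m T ^ 2 / m t ^ 2)
      (-2 * (m T ^ 2 * deriv m t / m t ^ 3)) t := by
    intro t
    have hm := g.pos t
    have := ((g.d1 t).pow 2).inv (pow_pos hm 2).ne' |>.const_mul (m T ^ 2)
    refine HasDerivAt.congr_deriv this ?_
    simp; field_simp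
  have h2 : ∀ t, |t| ≤ T → U t = m T ^ 2 / m t ^ 2 := by
    have hsub : ∀ t ∈ Ioo (-T) T, HasDerivAt (fun t => U t - m T ^ 2 / m t ^ 2) 0 t := by
      intro t ht
      have := (hd t).sub (hW t)
      rw [fT_eq (abs_le.2 ⟨ht.1.le, ht.2.le⟩)] at this
      simpa using! this
    have hcst : ∀ t ∈ Icc (-T) T, U t - m T ^ 2 / m t ^ 2 = U (-T) - m T ^ 2 / m (-T) ^ 2 := by
      apply constant_of_has_deriv_right_zero
      · exact fun t _ => ((hd t).sub (hW t)).continuousAt.continuousWithinAt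
      · intro t ht
        have := (hd t).sub (hW t)
        rw [fT_eq (abs_le.2 ⟨ht.1, ht.2.le⟩)] at this
        have h3 : HasDerivAt (fun t => U t - m T ^ 2 / m t ^ 2) 0 t := by simpa using! this
        exact h3.hasDerivWithinAt
    intro t ht
    have e1 := hcst t (abs_le.1 ht)
    have e2 := hcst 0 ⟨by linarith [hT.1], hT.1.le⟩
    have e3 : U 0 = m T ^ 2 / m 0 ^ 2 := by simp [hU]
    linarith
  have hcU : Continuous U := continuous_iff_continuousAt.2 fun t => (hd t).continuousAt
  have hone : U T = 1 := by
    rw [h2 T (abs_of_pos hT.1).le, div_self (pow_pos (g.pos T) 2).ne']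
  have hone' : U (-T) = 1 := by
    rw [h2 (-T) (by rw [abs_neg, abs_of_pos hT.1]), g.even, div_self (pow_pos (g.pos T) 2).ne']
  refine ⟨U, hd, h2, ?_⟩
  intro t ht
  by_contra hcon
  push Not at hcon
  rcases lt_abs.1 hcon with h | h
  · have hmono : StrictMonoOn U (Ici T) := by
      apply strictMonoOn_of_deriv_pos (convex_Ici T) hcU.continuousOn
      intro x hx
      rw [interior_Ici] at hx
      rw [(hd x).deriv]
      linarith [g.fT_neg hT (hT.1.trans hx)]
    have := hmono self_mem_Ici h.le h
    linarith
  · have hmono : StrictAntiOn U (Iic (-T)) := by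
      apply strictAntiOn_of_deriv_neg (convex_Iic (-T)) hcU.continuousOn
      intro x hx
      rw [interior_Iic] at hx
      rw [(hd x).deriv]
      have h1 : fT m T (-x) < 0 := g.fT_neg hT (by linarith [hT.1, mem_Iio.1 hx])
      rw [g.fT_odd hT.1.le] at h1
      linarith
    have := hmono (a := t) (b := -T) (by simp; linarith) self_mem_Iic (by linarith)
    linarith

theorem canon_exists (g : Good m t₀) {T : ℝ} (hT : T ∈ Ioo 0 t₀) :
    ∃ σ v Θ : ℝ → ℝ, ∃ h : ℝ, Canon m T σ v Θ h := by
  obtain ⟨K, hK⟩ := g.fT_lip hT.1.le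
  obtain ⟨M, hM⟩ := g.fT_bdd hT.1.le
  have hodd := g.fT_odd hT.1.le
  obtain ⟨U, hU, hU1, hU2⟩ := g.potential hT
  have hmT := g.pos T
  have hm0 := g.pos 0
  have hlt0 : m T ^ 2 / m 0 ^ 2 < 1 := by
    rw [div_lt_one (by positivity)]; exact g.sq_lt (g.lt_m0 ⟨hT.1, hT.2.le⟩)
  obtain ⟨σ, v, hσ0, hv0, dσ, dv⟩ := ode2_exists hK hM 0 (Real.sqrt (1 - m T ^ 2 / m 0 ^ 2))
  have hv0pos : 0 < v 0 := by rw [hv0]; exact Real.sqrt_pos.2 (by linarith)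
  have hcσ : Continuous σ := continuous_iff_continuousAt.2 fun t => (dσ t).continuousAt
  have hcv : Continuous v := continuous_iff_continuousAt.2 fun t => (dv t).continuousAt
  have hE : ∀ s, v s ^ 2 + U (σ s) = 1 := by
    have hd : ∀ s, HasDerivAt (fun s => v s ^ 2 + U (σ s)) 0 s := by
      intro s
      have := ((dv s).pow 2).add ((hU (σ s)).comp s (dσ s))
      exact HasDerivAt.congr_deriv this (by simp; ring)
    intro s
    have := is_const_of_deriv_eq_zero (fun s => (hd s).differentiableAt) (fun s => (hd s).deriv) s 0
    rw [this, hσ0, hv0, hU1 0 (by simpa using hT.1.le), Real.sq_sqrt (by linarith)]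
    ring
  have bdd : ∀ s, |σ s| ≤ T := fun s => hU2 _ (by nlinarith [hE s, sq_nonneg (v s)])
  have energy : ∀ s, v s ^ 2 + m T ^ 2 / m (σ s) ^ 2 = 1 := by
    intro s; rw [← hU1 _ (bdd s)]; exact hE s
  have dneg : ∀ {x x' : ℝ → ℝ} (c s : ℝ), (∀ s, HasDerivAt x (x' s) s) →
      HasDerivAt (fun s => x (c - s)) (- x' (c - s)) s := by
    intro x x' c s hx
    have := (hx (c - s)).comp s ((hasDerivAt_id s).const_sub c)
    simpa using! this
  have sym : σ = (fun s => - σ (0 - s)) ∧ v = fun s => v (0 - s) := by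
    apply ode2_unique hK dσ dv (y := fun s => - σ (0 - s)) (w := fun s => v (0 - s)) _ _ 0
      (by simp [hσ0]) (by simp)
    · intro s
      have := (dneg 0 s dσ).neg
      rw [neg_neg] at this
      exact this
    · intro s
      have := dneg 0 s dv
      rw [hodd]
      exact this
  have σodd : ∀ s, σ (-s) = - σ s := by
    intro s
    have := congrFun sym.1 s
    simp only [zero_sub] at this
    linarith
  have vev : ∀ s, v (-s) = v s := by
    intro s
    have := congrFun sym.2 s
    simp only [zero_sub] at this
    exact this.symm
  -- existence of a zero of `v`
  have hzero : ∃ s, 0 ≤ s ∧ v s = 0 := by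
    by_contra hcon
    push Not at hcon
    have hvpos : ∀ s, 0 ≤ s → 0 < v s := by
      intro s hs
      by_contra h
      push Not at h
      obtain ⟨r, hr, hr0⟩ := intermediate_value_Icc' hs hcv.continuousOn ⟨h, hv0pos.le⟩
      exact hcon r hr.1 hr0
    have hmono : StrictMonoOn σ (Ici 0) := by
      apply strictMonoOn_of_deriv_pos (convex_Ici 0) hcσ.continuousOn
      intro x hx
      rw [(dσ x).deriv]; exact hvpos x (interior_subset hx)
    have h1 : 0 < σ 1 := by
      have := hmono (a := 0) (b := 1) (by simp) (by simp) one_pos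
      rwa [hσ0] at this
    have h1T : σ 1 ≤ T := (le_abs_self _).trans (bdd 1)
    obtain ⟨x, hx, hmax⟩ := isCompact_Icc.exists_isMaxOn (nonempty_Icc.2 h1T)
      (g.fT_cont T).continuousOn
    set δ := - fT m T x with hδ
    have hδpos : 0 < δ := by have := g.fT_neg hT (h1.trans_le hx.1); linarith
    have hder : ∀ s, 1 ≤ s → fT m T (σ s) ≤ -δ := by
      intro s hs
      have : σ 1 ≤ σ s := hmono.monotoneOn (by simp) (by simp; linarith) hs
      have := hmax (show σ s ∈ Icc (σ 1) T from ⟨this, (le_abs_self _).trans (bdd s)⟩)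
      simp only [mem_setOf_eq] at this
      linarith
    have hanti : AntitoneOn (fun s => v s + δ * s) (Ici 1) := by
      have hd : ∀ s, HasDerivAt (fun s => v s + δ * s) (fT m T (σ s) + δ) s := by
        intro s
        have := (dv s).add ((hasDerivAt_id s).const_mul δ)
        simpa using! this
      apply antitoneOn_of_deriv_nonpos (convex_Ici 1)
      · exact fun s _ => (hd s).continuousAt.continuousWithinAt
      · exact fun s _ => (hd s).differentiableAt.differentiableWithinAt
      · intro s hs
        rw [(hd s).deriv]
        have := hder s (interior_subset hs)
        linarith
    set s := 1 + v 1 / δ with hs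
    have hv1 := hvpos 1 zero_le_one
    have hs1 : 1 ≤ s := by rw [hs]; have : 0 < v 1 / δ := by positivity
                           linarith
    have h3 := hanti (a := 1) (b := s) self_mem_Ici hs1 hs1
    have h4 := hvpos s (by linarith)
    have h5 : δ * s = δ + v 1 := by rw [hs]; field_simp
    simp only at h3
    linarith
  obtain ⟨s1, hs1, hvs1⟩ := hzero
  obtain ⟨h, ⟨hh0, hvh⟩, hleast⟩ : ∃ h, IsLeast {s | s ∈ Icc 0 s1 ∧ v s = 0} h := by
    apply IsCompact.exists_isLeast
    · exact isCompact_Icc.inter_right (isClosed_eq hcv continuous_const)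
    · exact ⟨s1, ⟨hs1, le_refl _⟩, hvs1⟩
  have hpos : 0 < h := by
    rcases hh0.1.eq_or_lt with e | e
    · rw [← e] at hvh; linarith
    · exact e
  have vpos : ∀ s ∈ Ico 0 h, 0 < v s := by
    intro s hs
    by_contra hc
    push Not at hc
    obtain ⟨r, hr, hr0⟩ := intermediate_value_Icc' hs.1 hcv.continuousOn ⟨hc, hv0pos.le⟩
    have := hleast ⟨⟨hr.1, hr.2.trans (hs.2.le.trans hh0.2)⟩, hr0⟩
    linarith [hr.2, hs.2]
  have hmono : StrictMonoOn σ (Icc 0 h) := by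
    apply strictMonoOn_of_deriv_pos (convex_Icc 0 h) hcσ.continuousOn
    intro x hx
    rw [interior_Icc] at hx
    rw [(dσ x).deriv]; exact vpos x ⟨hx.1.le, hx.2⟩
  have hσhpos : 0 < σ h := by
    have := hmono ⟨le_refl _, hpos.le⟩ ⟨hpos.le, le_refl _⟩ hpos
    rwa [hσ0] at this
  have σh : σ h = T := by
    apply le_antisymm ((le_abs_self _).trans (bdd h))
    by_contra hc
    push Not at hc
    have h1 := g.lt_of_abs hT.2.le (t := σ h) (by rwa [abs_of_pos hσhpos])
    have h2 := energy h
    rw [hvh] at h2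
    have h3 : m T ^ 2 / m (σ h) ^ 2 < 1 := by
      rw [div_lt_one (pow_pos (g.pos _) 2)]; exact g.sq_lt h1
    linarith
  have sym2 : σ = (fun s => σ (2 * h - s)) ∧ v = fun s => - v (2 * h - s) := by
    apply ode2_unique hK dσ dv (y := fun s => σ (2 * h - s)) (w := fun s => - v (2 * h - s)) _ _ h
      (by simp [two_mul]) (by simp [two_mul, hvh])
    · intro s
      exact dneg (2 * h) s dσ
    · intro s
      have := (dneg (2 * h) s dv).neg
      rw [neg_neg] at this
      exact this
  have σrefl : ∀ s, σ (2 * h - s) = σ s := fun s => (congrFun sym2.1 s).symm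
  have hcω : Continuous (fun s => m T / m (σ s) ^ 2) :=
    continuous_const.div ((g.c0.comp hcσ).pow 2) (fun s => (pow_pos (g.pos _) 2).ne')
  set Θ : ℝ → ℝ := fun s => ∫ r in (0:ℝ)..s, m T / m (σ r) ^ 2 with hΘ
  have dΘ : ∀ s, HasDerivAt Θ (m T / m (σ s) ^ 2) s := fun s =>
    intervalIntegral.integral_hasDerivAt_right (hcω.intervalIntegrable _ _)
      (hcω.stronglyMeasurableAtFilter _ _) hcω.continuousAt
  have Θ0 : Θ 0 = 0 := by simp [hΘ]
  have Θodd : ∀ s, Θ (-s) = - Θ s := by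
    have hd : ∀ s, HasDerivAt (fun s => Θ (0 - s) + Θ s) 0 s := by
      intro s
      have := (dneg 0 s dΘ).add (dΘ s)
      rw [zero_sub, σodd, g.even] at this
      simpa using! this
    intro s
    have := is_const_of_deriv_eq_zero (fun s => (hd s).differentiableAt) (fun s => (hd s).deriv) s 0
    simp only [zero_sub, neg_zero, Θ0] at this
    linarith
  have Θrefl : ∀ s, Θ (2 * h - s) = 2 * Θ h - Θ s := by
    have hd : ∀ s, HasDerivAt (fun s => Θ (2 * h - s) + Θ s) 0 s := by
      intro s
      have := (dneg (2 * h) s dΘ).add (dΘ s)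
      rw [σrefl] at this
      simpa using! this
    intro s
    have := is_const_of_deriv_eq_zero (fun s => (hd s).differentiableAt) (fun s => (hd s).deriv) s h
    simp only [show 2 * h - h = h by ring] at this
    linarith
  have hlt : ∀ s ∈ Ico 0 h, |σ s| < T := by
    intro s hs
    have h1 : 0 ≤ σ s := by
      rw [← hσ0]; exact hmono.monotoneOn ⟨le_refl _, hpos.le⟩ ⟨hs.1, hs.2.le⟩ hs.1
    rw [abs_of_nonneg h1, ← σh]
    exact hmono ⟨hs.1, hs.2.le⟩ ⟨hpos.le, le_refl _⟩ hs.2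
  have hGv : ∀ s ∈ Ico 0 h, Gf m (m T) (σ s) = v s := by
    intro s hs
    have : 1 - m T ^ 2 / m (σ s) ^ 2 = v s ^ 2 := by linarith [energy s]
    rw [Gf, this, Real.sqrt_sq (vpos s hs).le]
  have Θh : 2 * Θ h = phi m (m T) := by
    rw [phi, g.xi_eq hT]
    congr 1
    have hmin : min 0 h = 0 := min_eq_left hpos.le
    have hmax : max 0 h = h := max_eq_right hpos.le
    have hcov := intervalIntegral.integral_comp_mul_deriv_of_deriv_nonneg (a := 0) (b := h)
      (f := σ) (f' := v) (g := fun t => m T / (m t * Real.sqrt (m t ^ 2 - m T ^ 2)))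
      hcσ.continuousOn (fun s _ => dσ s)
      (by rw [hmin, hmax]; exact fun s hs => (vpos s ⟨hs.1.le, hs.2⟩).le)
    rw [hσ0, σh] at hcov
    rw [← hcov, hΘ]
    simp only
    rw [intervalIntegral.integral_of_le hpos.le, intervalIntegral.integral_of_le hpos.le,
      MeasureTheory.integral_Ioc_eq_integral_Ioo, MeasureTheory.integral_Ioc_eq_integral_Ioo]
    apply MeasureTheory.setIntegral_congr_fun measurableSet_Ioo
    intro s hs
    have hs' : s ∈ Ico 0 h := ⟨hs.1.le, hs.2⟩
    have hm := g.pos (σ s)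
    have h2 : 0 < m (σ s) ^ 2 - m T ^ 2 := sub_pos.2 (g.sq_lt (g.lt_of_abs hT.2.le (hlt s hs')))
    have h3 : 1 - m T ^ 2 / m (σ s) ^ 2 = (m (σ s) ^ 2 - m T ^ 2) / m (σ s) ^ 2 := by field_simp
    have h4 := Real.sqrt_pos.2 h2
    simp only [Function.comp]
    rw [← hGv s hs', Gf, h3, Real.sqrt_div h2.le, Real.sqrt_sq hm.le]
    field_simp
  have len : 2 * h = m T * phi m (m T) + 2 * GG m (m T) T := by
    have hd : ∀ s, HasDerivAt (fun s => m T * Θ s + GG m (m T) (σ s) - s)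
        (m T * (m T / m (σ s) ^ 2) + Gf m (m T) (σ s) * v s - 1) s := fun s =>
      (((dΘ s).const_mul (m T)).add ((g.GG_hd (m T) (σ s)).comp s (dσ s))).sub (hasDerivAt_id s)
    have hc := constant_of_has_deriv_right_zero (a := 0) (b := h)
      (f := fun s => m T * Θ s + GG m (m T) (σ s) - s)
      (fun s _ => (hd s).continuousAt.continuousWithinAt)
      (fun s hs => by
        have h1 := hd s
        have h2 : m T * (m T / m (σ s) ^ 2) + Gf m (m T) (σ s) * v s - 1 = 0 := by
          rw [hGv s hs]
          have := energy s
          rw [← this]; ring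
        rw [h2] at h1
        exact h1.hasDerivWithinAt) h ⟨hpos.le, le_refl _⟩
    have hG0 : GG m (m T) 0 = 0 := by simp [GG]
    simp only [σh, hσ0, Θ0, hG0] at hc
    rw [← Θh]
    linarith
  exact ⟨σ, v, Θ, h, dσ, dv, dΘ, hσ0, Θ0, energy, bdd, σodd, vev, Θodd, hpos, vpos, σh, hvh,
    σrefl, Θrefl, Θh, len⟩

end Good

theorem c2_of {x v f : ℝ → ℝ} (h1 : ∀ s, HasDerivAt x (v s) s) (h2 : ∀ s, HasDerivAt v (f s) s)
    (hf : Continuous f) : ContDiff ℝ 2 x := by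
  have hv : ContDiff ℝ 1 v := by
    rw [contDiff_one_iff_deriv]
    refine ⟨fun s => (h2 s).differentiableAt, ?_⟩
    rwa [show deriv v = f from funext fun s => (h2 s).deriv]
  have e : (2 : WithTop ℕ∞) = 1 + 1 := by norm_num
  rw [e, contDiff_succ_iff_deriv]
  refine ⟨fun s => (h1 s).differentiableAt, by simp, ?_⟩
  rwa [show deriv x = v from funext fun s => (h1 s).deriv]

/-- Reflected, shifted copy of the canonical geodesic. -/
def cc (σ Θ : ℝ → ℝ) (e a c : ℝ) (s : ℝ) : ℝ × ℝ := (e * σ (s + a), Θ (s + a) + c)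

namespace Good
variable {m : ℝ → ℝ} {t₀ : ℝ}

theorem deriv_odd (g : Good m t₀) (t : ℝ) : deriv m (-t) = - deriv m t := by
  have h : m = fun t => m (-t) := funext fun t => (g.even t).symm
  have : deriv (fun t => m (-t)) t = - deriv m (-t) := deriv_comp_neg m t
  rw [← h] at this
  linarith

theorem m_sign (g : Good m t₀) {e : ℝ} (he : e = 1 ∨ e = -1) (t : ℝ) : m (e * t) = m t := by
  rcases he with rfl | rfl
  · simp
  · simpa using g.even t

theorem dm_sign (g : Good m t₀) {e : ℝ} (he : e = 1 ∨ e = -1) (t : ℝ) :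
    deriv m (e * t) = e * deriv m t := by
  rcases he with rfl | rfl
  · simp
  · simpa using g.deriv_odd t

theorem fT_sign (g : Good m t₀) {T : ℝ} (hT : 0 ≤ T) {e : ℝ} (he : e = 1 ∨ e = -1) (t : ℝ) :
    fT m T (e * t) = e * fT m T t := by
  rcases he with rfl | rfl
  · simp
  · simpa using g.fT_odd hT t

variable {T h : ℝ} {σ v Θ : ℝ → ℝ}

theorem cc_d1 (k : Canon m T σ v Θ h) (e a s : ℝ) :
    HasDerivAt (fun s => e * σ (s + a)) (e * v (s + a)) s :=
  ((k.dσ (s + a)).comp_add_const s a).const_mul e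

theorem cc_d2 (k : Canon m T σ v Θ h) (e a s : ℝ) :
    HasDerivAt (fun s => e * v (s + a)) (e * fT m T (σ (s + a))) s :=
  ((k.dv (s + a)).comp_add_const s a).const_mul e

theorem cc_d3 (k : Canon m T σ v Θ h) (a c s : ℝ) :
    HasDerivAt (fun s => Θ (s + a) + c) (m T / m (σ (s + a)) ^ 2) s :=
  ((k.dΘ (s + a)).comp_add_const s a).add_const c

theorem cc_geod (g : Good m t₀) (k : Canon m T σ v Θ h) {e : ℝ} (he : e = 1 ∨ e = -1) (a c : ℝ) :
    IsUnitGeodesic m (cc σ Θ e a c) ∧ HasClairaut m (cc σ Θ e a c) (m T) := by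
  have e1 : deriv (fun s => e * σ (s + a)) = fun s => e * v (s + a) :=
    funext fun s => (cc_d1 k e a s).deriv
  have e2 : deriv (fun s => e * v (s + a)) = fun s => e * fT m T (σ (s + a)) :=
    funext fun s => (cc_d2 k e a s).deriv
  have e3 : deriv (fun s => Θ (s + a) + c) = fun s => m T / m (σ (s + a)) ^ 2 :=
    funext fun s => (cc_d3 k a c s).deriv
  have hσ : Continuous σ := continuous_iff_continuousAt.2 fun s => (k.dσ s).continuousAt
  have hv : Continuous v := continuous_iff_continuousAt.2 fun s => (k.dv s).continuousAt
  have he2 : e ^ 2 = 1 := by rcases he with rfl | rfl <;> norm_num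
  have hcl : ∀ s, m (e * σ (s + a)) ^ 2 * deriv (fun s => Θ (s + a) + c) s = m T := by
    intro s
    rw [e3, g.m_sign he]
    have := (g.pos (σ (s + a))).ne'
    field_simp
  refine ⟨⟨?_, ?_, ⟨m T, hcl⟩, ?_⟩, hcl⟩
  · refine ContDiff.prodMk ?_ ?_
    · exact c2_of (cc_d1 k e a) (cc_d2 k e a)
        (continuous_const.mul ((g.fT_cont T).comp (hσ.comp (continuous_id.add continuous_const))))
    · have hs : ContDiff ℝ 1 (fun s => σ (s + a)) := by
        have := c2_of (cc_d1 k 1 a) (cc_d2 k 1 a)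
          (continuous_const.mul ((g.fT_cont T).comp (hσ.comp (continuous_id.add continuous_const))))
        simp only [one_mul] at this
        exact this.of_le (by norm_num)
      have h1 : ContDiff ℝ 1 (fun s => m T / m (σ (s + a)) ^ 2) := by
        refine contDiff_const.div (((g.smooth.of_le (by exact_mod_cast le_top)).comp hs).pow 2) ?_
        intro s
        exact (pow_pos (g.pos _) 2).ne'
      exact c2_of (cc_d3 k a c) (c1_hd h1) (c1_cd h1)
  · intro s
    simp only [cc]
    rw [e1, e2, e3, g.m_sign he, g.dm_sign he]
    simp only []
    rw [fT_eq (k.bdd _)]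
    have := (g.pos (σ (s + a))).ne'
    field_simp
  · intro s
    simp only [cc]
    rw [e1, e3, g.m_sign he]
    simp only []
    have := (g.pos (σ (s + a))).ne'
    have h1 := k.energy (s + a)
    rw [mul_pow, he2, one_mul]
    refine Eq.trans ?_ h1
    field_simp

theorem len_unit {γ : ℝ → ℝ × ℝ} (hγ : IsUnitGeodesic m γ) (a b : ℝ) : wLength m γ a b = b - a := by
  rw [wLength]
  simp_rw [hγ.2.2.2]
  simp

theorem geod_bdd (g : Good m t₀) {γ : ℝ → ℝ × ℝ} (hγ : IsUnitGeodesic m γ)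
    (hcl : HasClairaut m γ (m T)) (hT : T ∈ Ioo 0 t₀) (h0 : |(γ 0).1| ≤ T) (s : ℝ) :
    |(γ s).1| ≤ T := by
  have hc : ContDiff ℝ 1 γ := hγ.1.of_le (by norm_num)
  have hx := (fst_c1 hc).continuous.abs
  by_contra hn
  push Not at hn
  obtain ⟨r, hr1, hr2⟩ : ∃ r, r = min |(γ s).1| ((T + t₀) / 2) ∧ True := ⟨_, rfl, trivial⟩
  have hrT : T < r := by
    rw [hr1]; exact lt_min hn (by linarith [hT.2])
  have hrt : r < t₀ := by
    rw [hr1]; exact (min_le_right _ _).trans_lt (by linarith [hT.2])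
  have hrs : r ≤ |(γ s).1| := by rw [hr1]; exact min_le_left _ _
  obtain ⟨z, -, hz⟩ := intermediate_value_uIcc (a := 0) (b := s) hx.continuousOn
    (show r ∈ uIcc |(γ 0).1| |(γ s).1| from by
      rw [uIcc_of_le (by linarith)]; exact ⟨by linarith, hrs⟩)
  have hm : m (γ z).1 < m T := by
    rw [← g.abs_eq, show |(γ z).1| = r from hz]
    exact g.anti ⟨hT.1.le, hT.2.le⟩ ⟨by linarith [hT.1], hrt.le⟩ hrT
  have h1 := hcl z
  have h2 := hγ.2.2.2 z
  have h3 := g.pos (γ z).1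
  have h4 := g.pos T
  set d := deriv (fun u => (γ u).2) z
  have h5 : m (γ z).1 * (m (γ z).1 * d) = m T := by rw [← h1]; ring
  have h6 : (m (γ z).1 * d) ^ 2 ≤ 1 := by nlinarith [sq_nonneg (deriv (fun u => (γ u).1) z)]
  have h8 : m (γ z).1 * d ≤ 1 := by nlinarith
  nlinarith

/-- Uniqueness of geodesics. -/
theorem geod_unique (g : Good m t₀) (k : Canon m T σ v Θ h) (hT : T ∈ Ioo 0 t₀)
    {γ : ℝ → ℝ × ℝ} (hγ : IsUnitGeodesic m γ)
    (hcl : HasClairaut m γ (m T)) {e a c : ℝ} (he : e = 1 ∨ e = -1)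
    (h0 : γ 0 = cc σ Θ e a c 0) (h1 : deriv (fun s => (γ s).1) 0 * (e * v a) ≥ 0) :
    γ = cc σ Θ e a c := by
  have hc : ContDiff ℝ 1 γ := hγ.1.of_le (by norm_num)
  have he1 : |e| = 1 := by rcases he with rfl | rfl <;> norm_num
  have he2 : e ^ 2 = 1 := by rcases he with rfl | rfl <;> norm_num
  have hx0 : (γ 0).1 = e * σ a := by rw [h0]; simp [cc]
  have hb := g.geod_bdd hγ hcl hT (by rw [hx0, abs_mul, he1, one_mul]; exact k.bdd a)
  obtain ⟨K, hK⟩ := g.fT_lip hT.1.le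
  have hx2 : ContDiff ℝ 2 (fun s => (γ s).1) := contDiff_fst.comp hγ.1
  have hd : ContDiff ℝ 1 (deriv (fun s => (γ s).1)) := by
    have e : (2 : WithTop ℕ∞) = 1 + 1 := by norm_num
    rw [e, contDiff_succ_iff_deriv] at hx2
    exact hx2.2.2
  have hcl' : ∀ s, deriv (fun u => (γ u).2) s = m T / m (γ s).1 ^ 2 := by
    intro s
    rw [eq_div_iff (pow_pos (g.pos _) 2).ne', ← hcl s]; ring
  have hv : ∀ s, HasDerivAt (deriv (fun s => (γ s).1)) (fT m T (γ s).1) s := by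
    intro s
    refine (c1_hd hd s).congr_deriv ?_
    rw [hγ.2.1 s, fT_eq (hb s), hcl']
    have := (g.pos (γ s).1).ne'
    field_simp
  have key := ode2_unique hK (c1_hd (fst_c1 hc)) hv (y := fun s => e * σ (s + a))
    (w := fun s => e * v (s + a)) (cc_d1 k e a)
    (fun s => by rw [g.fT_sign hT.1.le he]; exact cc_d2 k e a s) 0 (by simpa using hx0) (by
      simp only [zero_add]
      have hE := hγ.2.2.2 0
      rw [hcl', hx0, g.m_sign he] at hE
      have hE' := k.energy a
      have hm := (g.pos (σ a)).ne'
      have hsq : deriv (fun s => (γ s).1) 0 ^ 2 = (e * v a) ^ 2 := by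
        rw [mul_pow, he2, one_mul]
        have : m (σ a) ^ 2 * (m T / m (σ a) ^ 2) ^ 2 = m T ^ 2 / m (σ a) ^ 2 := by field_simp
        linarith
      rcases sq_eq_sq_iff_eq_or_eq_neg.1 hsq with hh | hh
      · exact hh
      · rw [hh] at h1 ⊢
        have : e * v a = 0 := by nlinarith
        simp [this])
  have k1 : ∀ s, (γ s).1 = e * σ (s + a) := fun s => congrFun key.1 s
  have k2 : (fun s => (γ s).2) = fun s => Θ (s + a) + c := by
    have hder : ∀ s, deriv (fun s => (γ s).2 - (Θ (s + a) + c)) s = 0 := by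
      intro s
      have := ((c1_hd (snd_c1 hc) s).sub (cc_d3 k a c s)).deriv
      rw [hcl', k1, g.m_sign he, sub_self] at this
      exact this
    funext s
    have := is_const_of_deriv_eq_zero (f := fun s => (γ s).2 - (Θ (s + a) + c))
      (fun s => ((c1_hd (snd_c1 hc) s).sub (cc_d3 k a c s)).differentiableAt) hder s 0
    have h2 : (γ 0).2 = Θ (0 + a) + c := by rw [h0]; simp [cc]
    simp only [h2, sub_self] at this
    linarith
  funext s
  exact Prod.ext (k1 s) (congrFun k2 s)

theorem σ_mono (k : Canon m T σ v Θ h) : StrictMonoOn σ (Icc (-h) h) := by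
  refine strictMonoOn_of_deriv_pos (convex_Icc _ _)
    (fun s _ => (k.dσ s).continuousAt.continuousWithinAt) ?_
  intro s hs
  rw [interior_Icc] at hs
  rw [(k.dσ s).deriv]
  rcases le_total 0 s with h0 | h0
  · exact k.vpos s ⟨h0, hs.2⟩
  · rw [← k.vev]; exact k.vpos _ ⟨by linarith, by linarith [hs.1]⟩

theorem exists_su (k : Canon m T σ v Θ h) {u : ℝ} (hu : 0 < u) (huT : u ≤ T) :
    ∃ a, 0 < a ∧ a ≤ h ∧ σ a = u := by
  have hσ : Continuous σ := continuous_iff_continuousAt.2 fun s => (k.dσ s).continuousAt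
  obtain ⟨a, ha, h1⟩ := intermediate_value_Icc k.hpos.le hσ.continuousOn
    (show u ∈ Icc (σ 0) (σ h) by rw [k.σ0, k.σh]; exact ⟨hu.le, huT⟩)
  refine ⟨a, lt_of_le_of_ne ha.1 ?_, ha.2, h1⟩
  rintro rfl
  rw [k.σ0] at h1; linarith

/-- A unit-speed geodesic reaching `(u, φ(ν))` at time `2 * h` is minimal. -/
theorem minimal_of (g : Good m t₀) (k : Canon m T σ v Θ h) {u : ℝ} (hu : 0 < u) (huT : u ≤ T)
    (hT : T < t₀) {γ : ℝ → ℝ × ℝ} (hγ : IsUnitGeodesic m γ) (h0 : γ 0 = (-u, 0))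
    (h1 : γ (2 * h) = (u, phi m (m T))) : IsMinimalSeg m γ (2 * h) := by
  have hc : ContDiff ℝ 1 γ := hγ.1.of_le (by norm_num)
  have hj := joined_of_curve (m := m) hc (a := 0) (b := 2 * h) (by linarith [k.hpos])
  rw [len_unit hγ, sub_zero] at hj
  refine le_antisymm hj.dist_le ?_
  refine le_csInf ⟨_, hj⟩ ?_
  rintro _ ⟨c, b, hb, hc, e0, e1, rfl⟩
  rw [k.len]
  exact g.length_ge hu huT hT hc hb (e0.trans h0) (e1.trans h1)

theorem β_end (k : Canon m T σ v Θ h) {u a : ℝ} (ha : σ a = u) :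
    cc σ Θ 1 (-a) (Θ a) 0 = (-u, 0) ∧ cc σ Θ 1 (-a) (Θ a) (2 * h) = (u, phi m (m T)) := by
  constructor
  · simp [cc, k.σodd, k.Θodd, ha]
  · simp only [cc, ← sub_eq_add_neg, k.σrefl, k.Θrefl, ha, k.Θh]
    simp

theorem α_end (k : Canon m T σ v Θ h) {u a : ℝ} (ha : σ a = u) :
    cc σ Θ (-1) a (-Θ a) 0 = (-u, 0) ∧ cc σ Θ (-1) a (-Θ a) (2 * h) = (u, phi m (m T)) := by
  have h1 := k.σrefl (-a)
  have h2 := k.Θrefl (-a)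
  simp only [sub_neg_eq_add, k.σodd, k.Θodd, k.Θh] at h1 h2
  constructor
  · simp [cc, ha]
  · simp [cc, h1, h2, ha]

theorem part1 (g : Good m t₀) {u : ℝ} (hu : 0 < u) (huT : u ≤ T) (hT : T < t₀)
    (α β : ℝ → ℝ × ℝ) (s₂ : ℝ) (hα : IsUnitGeodesic m α) (hβ : IsUnitGeodesic m β)
    (α0 : α 0 = (-u, 0)) (β0 : β 0 = (-u, 0)) (cα : HasClairaut m α (m T))
    (cβ : HasClairaut m β (m T)) (dα : deriv (fun s => (α s).1) 0 < 0)
    (dβ : 0 < deriv (fun s => (β s).1) 0) (hl : IsLeast {s : ℝ | 0 < s ∧ (α s).1 = u} s₂) :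
    (IsMinimalSeg m α s₂ ∧ α s₂ = (u, phi m (m T)) ∧
         IsMinimalSeg m β s₂ ∧ β s₂ = (u, phi m (m T))) := by
  have hT' : T ∈ Ioo 0 t₀ := ⟨by linarith, hT⟩
  obtain ⟨σ, v, Θ, h, k⟩ := g.canon_exists hT'
  obtain ⟨a, ha0, hah, ha⟩ := exists_su k hu huT
  have hva : 0 ≤ v a := by
    rcases hah.lt_or_eq with h1 | h1
    · exact (k.vpos a ⟨ha0.le, h1⟩).le
    · rw [h1, k.vh]
  have eα : α = cc σ Θ (-1) a (-Θ a) :=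
    g.geod_unique k hT' hα cα (Or.inr rfl) (by rw [α0, (α_end k ha).1]) (by nlinarith)
  have eβ : β = cc σ Θ 1 (-a) (Θ a) :=
    g.geod_unique k hT' hβ cβ (Or.inl rfl) (by rw [β0, (β_end k ha).1])
      (by rw [k.vev]; nlinarith)
  have α1 : α (2 * h) = (u, phi m (m T)) := by rw [eα]; exact (α_end k ha).2
  have β1 : β (2 * h) = (u, phi m (m T)) := by rw [eβ]; exact (β_end k ha).2
  have hs : s₂ = 2 * h := by
    refine le_antisymm (hl.2 ⟨by linarith [k.hpos], by rw [α1]⟩) ?_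
    by_contra hn
    push Not at hn
    obtain ⟨h0, h1⟩ := hl.1
    have h2 : σ (s₂ + a) = - u := by
      rw [eα] at h1; simp only [cc] at h1; linarith
    have hmono := σ_mono k
    have hna : σ (-a) = -u := by rw [k.σodd, ha]
    rcases le_total (s₂ + a) h with h3 | h3
    · have := hmono ⟨by linarith, by linarith⟩ ⟨by linarith, h3⟩ (show -a < s₂ + a by linarith)
      linarith
    · have h4 := k.σrefl (s₂ + a)
      have := hmono (show -a ∈ Icc (-h) h from ⟨by linarith, by linarith⟩)
        (show 2 * h - (s₂ + a) ∈ Icc (-h) h from ⟨by linarith, by linarith⟩) (by linarith)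
      linarith
  rw [hs]
  exact ⟨g.minimal_of k hu huT hT hα α0 α1, α1, g.minimal_of k hu huT hT hβ β0 β1, β1⟩

end Good

namespace Good
variable {m : ℝ → ℝ} {t₀ : ℝ}

theorem part2 (g : Good m t₀) {u θ : ℝ} (hu : 0 < u) (hut : u < t₀) (hθ : phi m (m u) ≤ θ) :
    IsCutPoint m (-u, 0) (u, θ) := by
  obtain ⟨T, huT, hT, rfl⟩ := g.phi_surj hu hut hθ
  have hT' : T ∈ Ioo 0 t₀ := ⟨by linarith, hT⟩
  obtain ⟨σ, v, Θ, h, k⟩ := g.canon_exists hT'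
  obtain ⟨a, ha0, hah, ha⟩ := exists_su k hu huT
  have hβ := (g.cc_geod k (Or.inl rfl) (e := 1) (-a) (Θ a)).1
  obtain ⟨b0, b1⟩ := β_end k ha
  refine ⟨cc σ Θ 1 (-a) (Θ a), 2 * h, hβ, b0, by linarith [k.hpos], b1,
    g.minimal_of k hu huT hT hβ b0 b1, ?_⟩
  intro ε hε hmin
  obtain ⟨δ, hδ0, hδε, hδa⟩ : ∃ δ, 0 < δ ∧ δ ≤ ε ∧ δ ≤ 2 * a :=
    ⟨min ε (2 * a), lt_min hε (by linarith), min_le_left _ _, min_le_right _ _⟩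
  obtain ⟨w, hw⟩ : ∃ w, w = Θ (δ - a) + Θ a := ⟨_, rfl⟩
  have hΘc : Continuous Θ := continuous_iff_continuousAt.2 fun s => (k.dΘ s).continuousAt
  -- the mean value estimate
  obtain ⟨ξ, hξ, hξe⟩ := exists_hasDerivAt_eq_slope Θ (fun s => m T / m (σ s) ^ 2)
    (show -a < δ - a by linarith) hΘc.continuousOn (fun s _ => k.dΘ s)
  have hσξ : |σ ξ| < u := by
    have hmono := σ_mono k
    have i1 : ξ ∈ Icc (-h) h := ⟨by linarith [hξ.1], by linarith [hξ.2]⟩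
    have l1 := hmono (show -a ∈ Icc (-h) h from ⟨by linarith, by linarith⟩) i1 hξ.1
    have l2 := hmono i1 (show a ∈ Icc (-h) h from ⟨by linarith, by linarith⟩)
      (by linarith [hξ.2])
    rw [k.σodd, ha] at l1
    rw [ha] at l2
    exact abs_lt.2 ⟨l1, l2⟩
  have hmξ : m u < m (σ ξ) := g.lt_of_abs hut.le hσξ
  have hmT : m T ≤ m u := g.anti.antitoneOn ⟨hu.le, hut.le⟩ ⟨by linarith, hT.le⟩ huT
  have hmu := g.pos u
  have hmTp := g.pos T
  have hwe : w = δ * (m T / m (σ ξ) ^ 2) := by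
    rw [hξe, k.Θodd, hw]
    have : δ - a - -a = δ := by ring
    rw [this]
    field_simp
    ring
  have hr : m u * (m T / m (σ ξ) ^ 2) < 1 := by
    rw [← mul_div_assoc, div_lt_one (by nlinarith)]
    nlinarith
  have hw0 : 0 ≤ w := by
    rw [hwe]; exact mul_nonneg hδ0.le (div_nonneg hmTp.le (sq_nonneg _))
  have hwlt : m u * w < δ := by
    rw [hwe]; nlinarith
  -- the parallel
  have hp : ContDiff ℝ 1 (fun s : ℝ => ((-u, s) : ℝ × ℝ)) := contDiff_const.prodMk contDiff_id
  have j1 := joined_of_curve (m := m) hp (a := 0) (b := 2 * w) (by linarith)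
  have lp : wLength m (fun s : ℝ => ((-u, s) : ℝ × ℝ)) 0 (2 * w) = m u * (2 * w) := by
    simp only [wLength, g.even]
    simp [Real.sqrt_sq hmu.le, mul_comm]
  rw [lp] at j1
  -- the translated reflected geodesic
  have hα := (g.cc_geod k (Or.inr rfl) (e := -1) a (-Θ a + 2 * w)).1
  have j2 := joined_of_curve (m := m) (hα.1.of_le (by norm_num)) (a := 0) (b := 2 * h - δ)
    (by linarith)
  rw [len_unit hα] at j2
  have j3 := joined_of_curve (m := m) (hβ.1.of_le (by norm_num)) (a := 2 * h + δ) (b := 2 * h + ε)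
    (by linarith)
  rw [len_unit hβ] at j3
  have p1 : cc σ Θ (-1) a (-Θ a + 2 * w) 0 = (-u, 2 * w) := by simp [cc, ha]
  have p2 : cc σ Θ (-1) a (-Θ a + 2 * w) (2 * h - δ) = cc σ Θ 1 (-a) (Θ a) (2 * h + δ) := by
    have q1 : 2 * h - δ + a = 2 * h - (δ - a) := by ring
    have q2 : 2 * h + δ + -a = 2 * h - (-(δ - a)) := by ring
    simp only [cc]
    rw [q1, q2, k.σrefl, k.σrefl, k.Θrefl, k.Θrefl, k.σodd, k.Θodd, hw]
    refine Prod.ext ?_ ?_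
    · simp
    · simp only []; ring
  rw [p1, p2] at j2
  have hd := ((j1.trans g.c0 j2).trans g.c0 j3).dist_le
  rw [← b0, hmin] at hd
  linarith

end Good

/-- Lemma 5.3: let `q = (-u,0)` with `0 < u < t₀`.  For every
`ν ∈ (inf m, m u]`, the geodesic segments `α_ν|[0,s₂(ν)]` and `β_ν|[0,s₂(ν)]` are minimal
geodesic segments joining `q` to the point `(u, φ(ν))`; in particular the set
`{(u,θ) | θ ≥ φ(m u)}` is contained in the cut locus of `q`. -/
theorem stmt15 (m : ℝ → ℝ) (hm : ContDiff ℝ (⊤:ℕ∞) m) (hmpos : ∀ t, 0 < m t)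
    (hmeven : ∀ t, m (-t) = m t)
    (hK0 : 0 < gaussK m 0) (hKdec : AntitoneOn (gaussK m) (Ici 0))
    (u : ℝ) (hu : 0 < u) (hut : u < tZero m) :
    (∀ ν : ℝ, infm m < ν → ν ≤ m u →
      ∀ α β : ℝ → ℝ × ℝ, ∀ s₂ : ℝ,
        IsUnitGeodesic m α → IsUnitGeodesic m β →
        α 0 = (-u, 0) → β 0 = (-u, 0) →
        HasClairaut m α ν → HasClairaut m β ν →
        deriv (fun s => (α s).1) 0 < 0 → 0 < deriv (fun s => (β s).1) 0 →
        IsLeast {s : ℝ | 0 < s ∧ (α s).1 = u} s₂ →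
        (IsMinimalSeg m α s₂ ∧ α s₂ = (u, phi m ν) ∧
         IsMinimalSeg m β s₂ ∧ β s₂ = (u, phi m ν))) ∧
    {z : ℝ × ℝ | z.1 = u ∧ phi m (m u) ≤ z.2} ⊆ cutLocus m (-u, 0) := by
  have g := good_of m hm hmpos hmeven hKdec u hu hut
  refine ⟨?_, ?_⟩
  · intro ν h1 h2 α β s₂ hα hβ α0 β0 cα cβ dα dβ hl
    rw [g.infm_eq] at h1
    obtain ⟨T, huT, hT, rfl⟩ := g.exists_T hut h1 h2
    exact g.part1 hu huT hT α β s₂ hα hβ α0 β0 cα cβ dα dβ hl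
  · rintro ⟨x, θ⟩ ⟨hx, hθ⟩
    simp only at hx hθ
    subst hx
    exact g.part2 hu hut hθ
end
end
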